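/- arXiv:2307.07833 — 3 statements merged into one kernel-verified Lean document; each statement's English description precedes it below -/
import Mathlib

section
/- The q-adjacency matrix A, viewed as a linear operator on V = ℂ^X, is diagonalizable, and its set of eigenvalues is exactly {θ_i : i ∈ [N]}, a set of 2N+1 distinct real numbers. -/
open Module Matrix Finset

noncomputable section

open scoped Classical

variable {F H : Type} [Field F] [Fintype F] [AddCommGroup H] [Module F H]
  [FiniteDimensional F H]

/-- The vertex set of the Attenuated Space poset `A_q(N,M)`:
the subspaces of `H` that intersect `h` trivially. -/
def AttX (h : Submodule F H) := {y : Submodule F H // y ⊓ h = ⊥}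

instance (h : Submodule F H) : Fintype (AttX h) := by
  have : Finite H := Module.finite_of_finite F
  have : Finite (Submodule F H) :=
    Finite.of_injective (fun y : Submodule F H => (y : Set H)) SetLike.coe_injective
  have : Finite (AttX h) := Subtype.finite
  exact Fintype.ofFinite _

/-- The dimension of a vertex. -/
def vdim (h : Submodule F H) (y : AttX h) : ℕ := finrank F (y.1 : Submodule F H)

/-- `AttCovers h y z` means that `z` covers `y`: `y ⊆ z` and `dim z = dim y + 1`. -/
def AttCovers (h : Submodule F H) (y z : AttX h) : Prop :=
  y.1 ≤ z.1 ∧ vdim h z = vdim h y + 1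

/-- The raising matrix `R`: `(y,z)`-entry `1` if `y` covers `z`, else `0`. -/
def Rmat (h : Submodule F H) : Matrix (AttX h) (AttX h) ℂ :=
  fun y z => if AttCovers h z y then 1 else 0

/-- The lowering matrix `L'`: `(y,z)`-entry `1` if `z` covers `y`, else `0`. -/
def Lpmat (h : Submodule F H) : Matrix (AttX h) (AttX h) ℂ :=
  fun y z => if AttCovers h y z then 1 else 0

/-- The `q`-lowering matrix `L`: `(y,z)`-entry `q^(dim y)` if `z` covers `y`, else `0`. -/
def Lmat (h : Submodule F H) (q : ℕ) : Matrix (AttX h) (AttX h) ℂ :=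
  fun y z => if AttCovers h y z then (q : ℂ) ^ (vdim h y) else 0

/-- The `q`-adjacency matrix `A`: `(y,z)`-entry `1` if `y` covers `z`,
`q^(dim y)` if `z` covers `y`, and `0` otherwise. -/
def Amat (h : Submodule F H) (q : ℕ) : Matrix (AttX h) (AttX h) ℂ :=
  fun y z =>
    if AttCovers h z y then 1 else if AttCovers h y z then (q : ℂ) ^ (vdim h y) else 0

/-- The dual adjacency matrix `A*`: diagonal with `(y,y)`-entry `q^{-dim y}`. -/
def Astar (h : Submodule F H) (q : ℕ) : Matrix (AttX h) (AttX h) ℂ :=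
  Matrix.diagonal fun y => (q : ℂ) ^ (-(vdim h y : ℤ))

/-- The matrix `S`: diagonal with `(y,y)`-entry `(-1)^(dim y)`. -/
def Smat (h : Submodule F H) : Matrix (AttX h) (AttX h) ℂ :=
  Matrix.diagonal fun y => (-1 : ℂ) ^ (vdim h y)

/-- The matrix `E*_i`: diagonal with `(y,y)`-entry `1` if `dim y = i`, else `0`. -/
def Estar (h : Submodule F H) (i : ℕ) : Matrix (AttX h) (AttX h) ℂ :=
  Matrix.diagonal fun y => if vdim h y = i then (1 : ℂ) else 0

/-- The eigenvalue `θ_i` for `i = k/2 ∈ [N] = {0, 1/2, 1, …, N}` (so `k = 0,…,2N`):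
`θ_i = (q^(N-i) - q^i)/(q - 1) · q^(M/2)`, written via `√q`. -/
def theta (q N M k : ℕ) : ℝ :=
  (Real.sqrt q ^ (2 * N - k) - Real.sqrt q ^ k) / ((q : ℝ) - 1) * Real.sqrt q ^ M

set_option linter.unusedSectionVars false

instance submoduleFintype : Fintype (Submodule F H) :=
  have : Finite H := Module.finite_of_finite F
  have : Finite (Submodule F H) :=
    Finite.of_injective (fun y : Submodule F H => (y : Set H)) SetLike.coe_injective
  Fintype.ofFinite _

/-! ### Characters attached to linear maps `h → H` -/

/-- The value at `y` of the character attached to `f : h → H`: if `f` differs from a map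
`a : h → h` by a map with values in `y`, this is `ψ (trace a)`; otherwise it is `0`. -/
def phase (ψ : AddChar F ℂ) {h : Submodule F H} (f : h →ₗ[F] H) (y : Submodule F H) : ℂ :=
  if hx : ∃ a : h →ₗ[F] h, ∀ x, f x - a x ∈ y then ψ (LinearMap.trace F h hx.choose) else 0

section phase

variable {ψ : AddChar F ℂ} {h y z : Submodule F H} {f g : h →ₗ[F] H}

theorem phase_eq (hy : y ⊓ h = ⊥) {a : h →ₗ[F] h} (ha : ∀ x, f x - a x ∈ y) :
    phase ψ f y = ψ (LinearMap.trace F h a) := by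
  have hx : ∃ a : h →ₗ[F] h, ∀ x, f x - a x ∈ y := ⟨a, ha⟩
  have : hx.choose = a := by
    ext x
    have h1 : (a x - hx.choose x : H) ∈ y := by
      simpa using y.sub_mem (hx.choose_spec x) (ha x)
    have h2 : (a x - hx.choose x : H) ∈ y ⊓ h :=
      ⟨h1, h.sub_mem (a x).2 (hx.choose x).2⟩
    rw [hy, Submodule.mem_bot, sub_eq_zero] at h2
    exact h2.symm
  rw [phase, dif_pos hx, this]

theorem exists_sub_mem (hy : y ⊓ h = ⊥) (hf : LinearMap.range f ≤ y ⊔ h) :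
    ∃ a : h →ₗ[F] h, ∀ x, f x - a x ∈ y := by
  obtain ⟨w, hyw, hw⟩ := (disjoint_iff.2 hy).exists_isCompl
  refine ⟨(h.projectionOnto w hw.symm).comp f, fun x => ?_⟩
  obtain ⟨u, hu, b, hb, hub⟩ := Submodule.mem_sup.1 (hf ⟨x, rfl⟩)
  have : h.projectionOnto w hw.symm (f x) = ⟨b, hb⟩ := by
    rw [← hub, map_add, Submodule.projectionOnto_apply_of_mem_right, zero_add]
    · exact Submodule.projectionOnto_apply_left hw.symm ⟨b, hb⟩
    · exact hyw hu
  rw [LinearMap.comp_apply, this, ← hub]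
  simpa using hu

theorem range_le_of_sub_mem {a : h →ₗ[F] h} (ha : ∀ x, f x - a x ∈ y) :
    LinearMap.range f ≤ y ⊔ h := by
  rintro _ ⟨x, rfl⟩
  exact Submodule.mem_sup.2 ⟨_, ha x, a x, (a x).2, by simp⟩

theorem phase_of_not_le (hf : ¬ LinearMap.range f ≤ y ⊔ h) : phase ψ f y = 0 :=
  dif_neg fun ⟨_, ha⟩ => hf (range_le_of_sub_mem ha)

theorem phase_ne_zero (hy : y ⊓ h = ⊥) (hf : LinearMap.range f ≤ y ⊔ h) :
    phase ψ f y ≠ 0 := by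
  obtain ⟨a, ha⟩ := exists_sub_mem hy hf
  rw [phase_eq hy ha]
  exact (AddChar.val_isUnit ψ _).ne_zero

theorem phase_of_le (hz : z ⊓ h = ⊥) (hyz : y ≤ z) (hf : LinearMap.range f ≤ y ⊔ h) :
    phase ψ f z = phase ψ f y := by
  have hy : y ⊓ h = ⊥ := le_bot_iff.1 ((inf_le_inf_right h hyz).trans hz.le)
  obtain ⟨a, ha⟩ := exists_sub_mem hy hf
  rw [phase_eq hy ha, phase_eq hz fun x => hyz (ha x)]

theorem phase_add (hy : y ⊓ h = ⊥) (hg : LinearMap.range g ≤ y ⊔ h) :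
    phase ψ (f + g) y = phase ψ f y * phase ψ g y := by
  obtain ⟨b, hb⟩ := exists_sub_mem hy hg
  by_cases hf : LinearMap.range f ≤ y ⊔ h
  · obtain ⟨a, ha⟩ := exists_sub_mem hy hf
    have hab : ∀ x, (f + g) x - (a + b) x ∈ y := fun x => by
      simpa [add_sub_add_comm] using y.add_mem (ha x) (hb x)
    rw [phase_eq hy ha, phase_eq hy hb, phase_eq hy hab, map_add, AddChar.map_add_eq_mul]
  · rw [phase_of_not_le hf, zero_mul, phase_of_not_le]
    intro hfg
    apply hf
    rintro _ ⟨x, rfl⟩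
    simpa using (y ⊔ h).sub_mem (hfg ⟨x, rfl⟩) (hg ⟨x, rfl⟩)

theorem exists_apply_ne_one (hψ : ψ ≠ 1) {V : Type*} [AddCommGroup V] [Module F V]
    {l : V →ₗ[F] F} (hl : l ≠ 0) : ∃ v, ψ (l v) ≠ 1 := by
  obtain ⟨c, hc⟩ := AddChar.ne_one_iff.1 hψ
  obtain ⟨v, hv⟩ : ∃ v, l v ≠ 0 := by
    by_contra! hv
    exact hl (LinearMap.ext hv)
  exact ⟨(c / l v) • v, by simpa [hv] using hc⟩

theorem exists_dual_apply_ne_one (hψ : ψ ≠ 1) {V : Type*} [AddCommGroup V] [Module F V]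
    {v : V} (hv : v ≠ 0) : ∃ l : V →ₗ[F] F, ψ (l v) ≠ 1 := by
  refine exists_apply_ne_one (V := Dual F V) hψ (l := Dual.eval F V v) fun h0 => hv ?_
  exact (forall_dual_apply_eq_zero_iff F v).1 fun l => LinearMap.congr_fun h0 l

end phase

/-! ### Counting subspaces -/

section counting

variable {V : Type} [AddCommGroup V] [Module F V] [FiniteDimensional F V]

theorem card_filter_mem [Fintype V] (W : Submodule F V) :
    #{v | v ∈ W} = Fintype.card F ^ finrank F W := by
  rw [← Module.card_eq_pow_finrank (K := F) (V := W), Fintype.card_subtype]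

theorem card_filter_mem_notMem [Fintype V] {W U : Submodule F V} (hUW : U ≤ W) :
    (#{v | v ∈ W ∧ v ∉ U} : ℂ)
      = (Fintype.card F : ℂ) ^ finrank F W - (Fintype.card F : ℂ) ^ finrank F U := by
  have := Finset.card_filter_add_card_filter_not (s := {v | v ∈ W}) (fun v => v ∈ U)
  rw [card_filter_mem, Finset.filter_filter, Finset.filter_filter,
    Finset.filter_congr (q := (· ∈ U)) fun v _ => ⟨fun h => h.2, fun h => ⟨hUW h, h⟩⟩,
    card_filter_mem] at this
  rw [eq_sub_iff_add_eq, add_comm]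
  exact_mod_cast this

/-- The subspaces of `T` covering `y` and meeting `Y` only in `y`. -/
def coversIn (y Y T : Submodule F V) : Finset (Submodule F V) :=
  {z | y ≤ z ∧ z ≤ T ∧ finrank F z = finrank F y + 1 ∧ z ⊓ Y = y}

theorem mem_coversIn {y Y T z : Submodule F V} :
    z ∈ coversIn y Y T ↔ y ≤ z ∧ z ≤ T ∧ finrank F z = finrank F y + 1 ∧ z ⊓ Y = y := by
  simp [coversIn]

theorem eq_sup_span {y z : Submodule F V} (hyz : y ≤ z) (hd : finrank F z = finrank F y + 1)
    {v : V} (hv : v ∈ z) (hvy : v ∉ y) : y ⊔ Submodule.span F {v} = z := by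
  refine Submodule.eq_of_le_of_finrank_le (sup_le hyz (by simpa using hv)) ?_
  have : y < y ⊔ Submodule.span F {v} :=
    left_lt_sup.2 fun hle => hvy (by simpa using hle)
  have := Submodule.finrank_lt_finrank_of_lt this
  omega

theorem finrank_sup_span {y : Submodule F V} {v : V} (hv : v ∉ y) :
    finrank F (y ⊔ Submodule.span F {v} : Submodule F V) = finrank F y + 1 := by
  have hdis : y ⊓ Submodule.span F {v} = ⊥ := by
    rw [← disjoint_iff, Submodule.disjoint_span_singleton' (by rintro rfl; simp at hv)]
    exact hv
  have h1 := Submodule.finrank_sup_add_finrank_inf_eq y (Submodule.span F {v})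
  rw [hdis, finrank_bot, finrank_span_singleton (by rintro rfl; simp at hv)] at h1
  simpa using h1

theorem card_coversIn {y Y T : Submodule F V} (hyY : y ≤ Y) (hYT : Y ≤ T) :
    (#(coversIn y Y T) : ℂ)
        * ((Fintype.card F : ℂ) ^ (finrank F y + 1) - (Fintype.card F : ℂ) ^ finrank F y)
      = (Fintype.card F : ℂ) ^ finrank F T - (Fintype.card F : ℂ) ^ finrank F Y := by
  have : Finite V := Module.finite_of_finite F
  have := Fintype.ofFinite V
  have key : ({v | v ∈ T ∧ v ∉ Y} : Finset V)
      = (coversIn y Y T).biUnion fun z => {v | v ∈ z ∧ v ∉ y} := by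
    ext v
    simp only [Finset.mem_biUnion, Finset.mem_filter, Finset.mem_univ, true_and, mem_coversIn]
    constructor
    · rintro ⟨hvT, hvY⟩
      have hvy : v ∉ y := fun hv => hvY (hyY hv)
      refine ⟨y ⊔ Submodule.span F {v}, ⟨le_sup_left,
        sup_le (hyY.trans hYT) (by simpa using hvT), finrank_sup_span hvy, ?_⟩,
        le_sup_right (a := y) (Submodule.mem_span_singleton_self v), hvy⟩
      rw [sup_comm, inf_comm, ← inf_sup_assoc_of_le _ hyY]
      have : Y ⊓ Submodule.span F {v} = ⊥ := by
        rw [← disjoint_iff, Submodule.disjoint_span_singleton' (by rintro rfl; simp at hvy)]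
        exact hvY
      rw [this, bot_sup_eq]
    · rintro ⟨z, ⟨-, hzT, -, hzY⟩, hvz, hvy⟩
      exact ⟨hzT hvz, fun hvY => hvy (hzY ▸ ⟨hvz, hvY⟩)⟩
  rw [← card_filter_mem_notMem hYT, key, Finset.card_biUnion]
  · push_cast
    rw [Finset.sum_congr rfl fun z hz => ?_, Finset.sum_const, nsmul_eq_mul]
    rw [mem_coversIn] at hz
    rw [card_filter_mem_notMem hz.1, hz.2.2.1]
  · intro z hz z' hz' hne
    rw [Finset.mem_coe, mem_coversIn] at hz hz'
    rw [Function.onFun, Finset.disjoint_left]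
    simp only [Finset.mem_filter, Finset.mem_univ, true_and]
    rintro v ⟨hv, hvy⟩ ⟨hv', -⟩
    exact hne ((eq_sup_span hz.1 hz.2.2.1 hv hvy).symm.trans
      (eq_sup_span hz'.1 hz'.2.2.1 hv' hvy))

/-- The hyperplanes of `Y` containing `T`. -/
def hyperplanesAbove (T Y : Submodule F V) : Finset (Submodule F V) :=
  {w | T ≤ w ∧ w ≤ Y ∧ finrank F w + 1 = finrank F Y}

theorem mem_hyperplanesAbove {T Y w : Submodule F V} :
    w ∈ hyperplanesAbove T Y ↔ T ≤ w ∧ w ≤ Y ∧ finrank F w + 1 = finrank F Y := by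
  simp [hyperplanesAbove]

theorem card_hyperplanesAbove {T Y : Submodule F V} (hTY : T ≤ Y) {k : ℕ}
    (hk : finrank F Y = finrank F T + k) :
    (#(hyperplanesAbove T Y) : ℂ) * ((Fintype.card F : ℂ) - 1)
      = (Fintype.card F : ℂ) ^ k - 1 := by
  have hcard : #(hyperplanesAbove T Y)
      = #(coversIn Y.dualAnnihilator Y.dualAnnihilator T.dualAnnihilator) := by
    let e := Subspace.orderIsoFiniteDimensional (K := F) (V := V)
    have hann (w w' : Submodule F V) : w.dualAnnihilator ≤ w'.dualAnnihilator ↔ w' ≤ w :=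
      e.le_iff_le (x := w') (y := w)
    refine Finset.card_bij (fun w _ => w.dualAnnihilator) ?_ ?_ ?_
    · intro w hw
      rw [mem_hyperplanesAbove] at hw
      have h1 := Subspace.finrank_add_finrank_dualAnnihilator_eq w
      have h2 := Subspace.finrank_add_finrank_dualAnnihilator_eq Y
      have h3 := (hann Y w).2 hw.2.1
      exact mem_coversIn.2 ⟨h3, (hann w T).2 hw.1, by omega, inf_eq_right.2 h3⟩
    · intro w _ w' _ hww
      exact e.injective hww
    · intro z hz
      rw [mem_coversIn] at hz
      obtain ⟨w, rfl⟩ : ∃ w : Submodule F V, w.dualAnnihilator = z := e.surjective z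
      have h1 := Subspace.finrank_add_finrank_dualAnnihilator_eq w
      have h2 := Subspace.finrank_add_finrank_dualAnnihilator_eq Y
      exact ⟨w, mem_hyperplanesAbove.2 ⟨(hann w T).1 hz.2.1, (hann Y w).1 hz.1, by omega⟩, rfl⟩
  have h1 := Subspace.finrank_add_finrank_dualAnnihilator_eq T
  have h2 := Subspace.finrank_add_finrank_dualAnnihilator_eq Y
  have h3 : finrank F T.dualAnnihilator = finrank F Y.dualAnnihilator + k := by omega
  have h4 := card_coversIn (le_refl Y.dualAnnihilator) (Submodule.dualAnnihilator_anti hTY)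
  rw [← hcard, h3, pow_succ, pow_add] at h4
  have hq : (Fintype.card F : ℂ) ^ finrank F Y.dualAnnihilator ≠ 0 :=
    pow_ne_zero _ (by exact_mod_cast Fintype.card_ne_zero)
  apply mul_left_cancel₀ hq
  linear_combination h4

end counting

/-! ### Sums over the covers of a vertex -/

section covers

variable {h : Submodule F H} {y z : AttX h} {U : Submodule F H}

theorem finrank_sup_attX (y : AttX h) :
    finrank F (y.1 ⊔ h : Submodule F H) = vdim h y + finrank F h := by
  have := Submodule.finrank_sup_add_finrank_inf_eq y.1 h
  rw [y.2, finrank_bot] at this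
  exact this

theorem inf_sup_eq_self_iff {w v : Submodule F H} (hv : v ⊓ h = ⊥) (hvw : v ≤ w) :
    w ⊓ (v ⊔ h) = v ↔ w ⊓ h = ⊥ := by
  rw [inf_comm, sup_inf_assoc_of_le _ hvw, sup_eq_left, inf_comm]
  refine ⟨fun hle => le_bot_iff.1 ?_, fun h0 => h0.le.trans bot_le⟩
  rw [← hv]
  exact le_inf hle inf_le_right

theorem card_covers_le {T : Submodule F H} (hT : y.1 ⊔ h ≤ T) :
    (#{z : AttX h | AttCovers h y z ∧ z.1 ≤ T} : ℂ)
        * ((Fintype.card F : ℂ) ^ (vdim h y + 1) - (Fintype.card F : ℂ) ^ vdim h y)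
      = (Fintype.card F : ℂ) ^ finrank F T
        - (Fintype.card F : ℂ) ^ (vdim h y + finrank F h) := by
  rw [← finrank_sup_attX, ← card_coversIn le_sup_left hT]
  congr 2
  refine Finset.card_bij (fun z _ => z.1) ?_ (fun _ _ _ _ => Subtype.ext) ?_
  · intro z hz
    obtain ⟨⟨hyz, hd⟩, hzT⟩ := (Finset.mem_filter.1 hz).2
    exact mem_coversIn.2 ⟨hyz, hzT, hd, (inf_sup_eq_self_iff y.2 hyz).2 z.2⟩
  · intro z hz
    obtain ⟨hyz, hzT, hd, hzY⟩ := mem_coversIn.1 hz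
    exact ⟨⟨z, (inf_sup_eq_self_iff y.2 hyz).1 hzY⟩,
      Finset.mem_filter.2 ⟨Finset.mem_univ _, ⟨hyz, hd⟩, hzT⟩, rfl⟩

theorem card_covered_ge (hhU : h ≤ U) (hU : U ≤ y.1 ⊔ h) {k : ℕ}
    (hk : finrank F (y.1 ⊔ h : Submodule F H) = finrank F U + k) :
    (#{z : AttX h | AttCovers h z y ∧ U ≤ z.1 ⊔ h} : ℂ) * ((Fintype.card F : ℂ) - 1)
      = (Fintype.card F : ℂ) ^ k - 1 := by
  have hUy : U ⊓ y.1 ⊔ h = U := by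
    rw [inf_comm, sup_comm, ← sup_inf_assoc_of_le _ hhU, sup_comm, inf_eq_right.2 hU]
  have hinf : U ⊓ y.1 ⊓ h = ⊥ := le_bot_iff.1 ((inf_le_inf_right h inf_le_right).trans y.2.le)
  have hk' : finrank F y.1 = finrank F (U ⊓ y.1 : Submodule F H) + k := by
    have h1 := Submodule.finrank_sup_add_finrank_inf_eq (U ⊓ y.1) h
    rw [hUy, hinf, finrank_bot] at h1
    rw [finrank_sup_attX, vdim] at hk
    omega
  rw [← card_hyperplanesAbove inf_le_right hk']
  congr 2
  refine Finset.card_bij (fun z _ => z.1) ?_ (fun _ _ _ _ => Subtype.ext) ?_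
  · intro z hz
    obtain ⟨⟨hzy, hd⟩, hUz⟩ := (Finset.mem_filter.1 hz).2
    refine mem_hyperplanesAbove.2 ⟨?_, hzy, hd.symm⟩
    calc U ⊓ y.1 ≤ (z.1 ⊔ h) ⊓ y.1 := inf_le_inf_right _ hUz
      _ = z.1 := by rw [inf_comm]; exact (inf_sup_eq_self_iff z.2 hzy).2 y.2
  · intro z hz
    obtain ⟨hUz, hzy, hd⟩ := mem_hyperplanesAbove.1 hz
    refine ⟨⟨z, le_bot_iff.1 ((inf_le_inf_right h hzy).trans y.2.le)⟩,
      Finset.mem_filter.2 ⟨Finset.mem_univ _, ⟨hzy, hd.symm⟩, ?_⟩, rfl⟩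
    rw [← hUy]
    exact sup_le_sup_right hUz h

variable {ψ : AddChar F ℂ} {f : h →ₗ[F] H}

theorem sum_covered (hhU : h ≤ U) (hfU : LinearMap.range f ≤ U) (hU : U ≤ y.1 ⊔ h) {k : ℕ}
    (hk : finrank F (y.1 ⊔ h : Submodule F H) = finrank F U + k) :
    (∑ z : AttX h with AttCovers h z y, if U ≤ z.1 ⊔ h then phase ψ f z.1 else 0)
        * ((Fintype.card F : ℂ) - 1)
      = ((Fintype.card F : ℂ) ^ k - 1) * phase ψ f y.1 := by
  have hphase : ∀ z ∈ ({z : AttX h | AttCovers h z y ∧ U ≤ z.1 ⊔ h} : Finset _),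
      phase ψ f z.1 = phase ψ f y.1 := fun z hz => by
    obtain ⟨⟨hzy, -⟩, hUz⟩ := (Finset.mem_filter.1 hz).2
    exact (phase_of_le y.2 hzy (hfU.trans hUz)).symm
  rw [← Finset.sum_filter, Finset.filter_filter, ← card_covered_ge hhU hU hk,
    Finset.sum_congr rfl hphase, Finset.sum_const, nsmul_eq_mul]
  ring

/-- The transvection `v ↦ v + l v • b` for `b` in the kernel of `l`. -/
def shear (l : H →ₗ[F] F) (b : H) (hb : l b = 0) : H ≃ₗ[F] H :=
  LinearEquiv.ofLinearMap (LinearMap.id + l.smulRight b) (LinearMap.id - l.smulRight b)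
    (by ext; simp [hb]) (by ext; simp [hb])

theorem shear_apply (l : H →ₗ[F] F) (b : H) (hb : l b = 0) (v : H) :
    shear l b hb v = v + l v • b := rfl

theorem sum_phase_eq_zero (hψ : ψ ≠ 1) (hy : ¬ LinearMap.range f ≤ y.1 ⊔ h) :
    (∑ z : AttX h with AttCovers h y z ∧ U ≤ z.1 ⊔ h, phase ψ f z.1) = 0 := by
  obtain ⟨_, ⟨x, rfl⟩, hx⟩ := Set.not_subset.1 hy
  obtain ⟨l, hlx, hl⟩ := Submodule.exists_le_ker_of_notMem hx
  have hly : ∀ v ∈ y.1, l v = 0 := fun v hv => hl (le_sup_left (a := y.1) hv)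
  have hlh : ∀ v ∈ h, l v = 0 := fun v hv => hl (le_sup_right (a := y.1) hv)
  have hlf : l ∘ₗ f ≠ 0 := fun h0 => hlx (LinearMap.congr_fun h0 x)
  obtain ⟨b, hb⟩ := exists_apply_ne_one hψ hlf
  have hbl : l (-b : H) = 0 := hlh _ (h.neg_mem b.2)
  let τ := shear l (-b : H) hbl
  have hτy : ∀ v ∈ y.1, τ v = v := fun v hv => by simp [τ, shear_apply, hly v hv]
  have hτh : ∀ v ∈ h, τ v = v := fun v hv => by simp [τ, shear_apply, hlh v hv]
  have hτsup (z : Submodule F H) : z.map (τ : H →ₗ[F] H) ⊔ h = z ⊔ h := by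
    apply le_antisymm
    · refine sup_le ?_ le_sup_right
      rintro _ ⟨v, hv, rfl⟩
      exact (z ⊔ h).add_mem (le_sup_left (a := z) hv)
        ((z ⊔ h).smul_mem _ (le_sup_right (a := z) (h.neg_mem b.2)))
    · refine sup_le (fun v hv => ?_) le_sup_right
      refine Submodule.mem_sup.2 ⟨τ v, ⟨v, hv, rfl⟩, l v • (b : H), h.smul_mem _ b.2, ?_⟩
      simp [τ, shear_apply]
  have hτinf (z : AttX h) : z.1.map (τ : H →ₗ[F] H) ⊓ h = ⊥ := by
    rw [eq_bot_iff]
    rintro _ ⟨⟨v, hv, rfl⟩, hvh⟩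
    have hvh' : v ∈ h := by
      have : τ (τ v) = τ v := hτh _ hvh
      rw [← τ.injective this]
      exact hvh
    have : v ∈ z.1 ⊓ h := ⟨hv, hvh'⟩
    rw [z.2, Submodule.mem_bot] at this
    simp [this]
  let e : AttX h → AttX h := fun z => ⟨z.1.map (τ : H →ₗ[F] H), hτinf z⟩
  have he : Function.Injective e := fun z z' hzz =>
    Subtype.ext (Submodule.map_injective_of_injective τ.injective (congrArg Subtype.val hzz))
  have hphase (z : AttX h) : phase ψ f (e z).1 = phase ψ f z.1 * ψ (l (f b)) := by
    by_cases hfz : LinearMap.range f ≤ z.1 ⊔ h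
    · obtain ⟨a, ha⟩ := exists_sub_mem z.2 hfz
      have ha' : ∀ x, f x - (a + (l ∘ₗ f).smulRight b) x ∈ (e z).1 := fun x => by
        refine ⟨f x - a x, ha x, ?_⟩
        have : τ (f x - a x) = f x - a x + l (f x - a x) • (-b : H) := rfl
        rw [LinearEquiv.coe_coe, this, map_sub, hlh _ (a x).2]
        simp
        abel
      rw [phase_eq (e z).2 ha', phase_eq z.2 ha, map_add, AddChar.map_add_eq_mul]
      simp
    · rw [phase_of_not_le hfz, phase_of_not_le, zero_mul]
      change ¬ _ ≤ z.1.map (τ : H →ₗ[F] H) ⊔ h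
      rwa [hτsup]
  have hmem : ∀ z : AttX h, AttCovers h y z ∧ U ≤ z.1 ⊔ h →
      AttCovers h y (e z) ∧ U ≤ (e z).1 ⊔ h := by
    rintro z ⟨⟨hyz, hd⟩, hUz⟩
    refine ⟨⟨fun v hv => ⟨v, hyz hv, hτy v hv⟩, ?_⟩, hUz.trans (hτsup z.1).ge⟩
    rw [← hd]
    exact LinearEquiv.finrank_map_eq τ z.1
  have hsum : (∑ z : AttX h with AttCovers h y z ∧ U ≤ z.1 ⊔ h, phase ψ f z.1)
      = (∑ z : AttX h with AttCovers h y z ∧ U ≤ z.1 ⊔ h, phase ψ f z.1) * ψ (l (f b)) := by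
    conv_lhs => rw [← Finset.eq_of_subset_of_card_le
      (s := ({z : AttX h | AttCovers h y z ∧ U ≤ z.1 ⊔ h} : Finset _).image e)
      (t := {z : AttX h | AttCovers h y z ∧ U ≤ z.1 ⊔ h})
      (fun z hz => by
        obtain ⟨w, hw, rfl⟩ := Finset.mem_image.1 hz
        exact Finset.mem_filter.2 ⟨Finset.mem_univ _, hmem w (Finset.mem_filter.1 hw).2⟩)
      (Finset.card_image_of_injective _ he).ge]
    rw [Finset.sum_image he.injOn, Finset.sum_mul]
    exact Finset.sum_congr rfl fun z _ => hphase z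
  have h0 : (∑ z : AttX h with AttCovers h y z ∧ U ≤ z.1 ⊔ h, phase ψ f z.1)
      * (ψ (l (f b)) - 1) = 0 := by linear_combination -hsum
  exact (mul_eq_zero.1 h0).resolve_right (sub_ne_zero.2 hb)

theorem sum_covering (hψ : ψ ≠ 1) :
    (∑ z : AttX h with AttCovers h y z ∧ U ≤ z.1 ⊔ h, phase ψ f z.1)
      = #{z : AttX h | AttCovers h y z ∧ U ≤ z.1 ⊔ h} * phase ψ f y.1 := by
  by_cases hf : LinearMap.range f ≤ y.1 ⊔ h
  · rw [Finset.sum_congr rfl fun z hz => ?_, Finset.sum_const, nsmul_eq_mul]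
    exact phase_of_le z.2 (Finset.mem_filter.1 hz).2.1.1 hf
  · rw [phase_of_not_le hf, mul_zero, sum_phase_eq_zero hψ hf]

end covers

/-! ### The action of the `q`-adjacency matrix -/

section action

variable {h : Submodule F H}

theorem toLin'_Amat_apply (q : ℕ) (x : AttX h → ℂ) (y : AttX h) :
    toLin' (Amat h q) x y = (∑ z : AttX h with AttCovers h z y, x z)
      + (q : ℂ) ^ vdim h y * ∑ z : AttX h with AttCovers h y z, x z := by
  have hA (z : AttX h) : Amat h q y z = (if AttCovers h z y then (1 : ℂ) else 0)
      + (q : ℂ) ^ vdim h y * if AttCovers h y z then (1 : ℂ) else 0 := by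
    by_cases h1 : AttCovers h z y
    · have h2 : ¬ AttCovers h y z := fun h2 => by
        have := h1.2
        have := h2.2
        omega
      simp [Amat, h1, h2]
    · simp [Amat, h1]
  rw [toLin'_apply, mulVec, dotProduct]
  simp_rw [hA, add_mul, Finset.sum_add_distrib, mul_assoc, ← Finset.mul_sum, ite_mul, one_mul,
    zero_mul, Finset.sum_filter]

/-- The vector with `y`-entry `t ^ dim y` times the character of `f`, where `U ≤ y + h`. -/
def wave (ψ : AddChar F ℂ) (f : h →ₗ[F] H) (t : ℂ) (U : Submodule F H) : AttX h → ℂ :=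
  fun y => if U ≤ y.1 ⊔ h then t ^ vdim h y * phase ψ f y.1 else 0

/-- The vector whose `y`-entry is the character of `f`, where `y + h = U`. -/
def layer (ψ : AddChar F ℂ) (f : h →ₗ[F] H) (U : Submodule F H) : AttX h → ℂ :=
  fun y => if y.1 ⊔ h = U then phase ψ f y.1 else 0

variable {ψ : AddChar F ℂ} {f : h →ₗ[F] H} {U : Submodule F H}

theorem sum_covering_wave (hψ : ψ ≠ 1) (t : ℂ) (y : AttX h) :
    (∑ z : AttX h with AttCovers h y z, wave ψ f t U z)
      = t ^ (vdim h y + 1) * #{z : AttX h | AttCovers h y z ∧ U ≤ z.1 ⊔ h}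
        * phase ψ f y.1 := by
  rw [mul_assoc, ← sum_covering hψ, Finset.mul_sum, ← Finset.filter_filter,
    Finset.sum_filter (fun z : AttX h => U ≤ z.1 ⊔ h)]
  refine Finset.sum_congr rfl fun z hz => ?_
  rw [wave, (Finset.mem_filter.1 hz).2.2]

theorem mul_sum_covered_wave (t : ℂ) (y : AttX h) :
    t * (∑ z : AttX h with AttCovers h z y, wave ψ f t U z)
      = t ^ vdim h y *
        ∑ z : AttX h with AttCovers h z y, if U ≤ z.1 ⊔ h then phase ψ f z.1 else 0 := by
  rw [Finset.mul_sum, Finset.mul_sum]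
  refine Finset.sum_congr rfl fun z hz => ?_
  rw [wave, (Finset.mem_filter.1 hz).2.2, mul_ite, mul_ite, pow_succ]
  simp only [mul_zero]
  congr 1
  ring

theorem sum_covered_wave_eq_zero (t : ℂ) {y : AttX h} (hU : ¬ U ≤ y.1 ⊔ h) :
    (∑ z : AttX h with AttCovers h z y, wave ψ f t U z) = 0 := by
  refine Finset.sum_eq_zero fun z hz => if_neg fun hUz => hU (hUz.trans ?_)
  exact sup_le_sup_right (Finset.mem_filter.1 hz).2.1 h

theorem card_covering_eq_pow {y : AttX h}
    (hd : finrank F (y.1 ⊔ h ⊔ U : Submodule F H)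
      = finrank F (y.1 ⊔ h : Submodule F H) + 1) :
    (#{z : AttX h | AttCovers h y z ∧ U ≤ z.1 ⊔ h} : ℂ)
      = (Fintype.card F : ℂ) ^ finrank F h := by
  have hS : ({z | AttCovers h y z ∧ U ≤ z.1 ⊔ h} : Finset (AttX h))
      = ({z | AttCovers h y z ∧ z.1 ≤ y.1 ⊔ h ⊔ U} : Finset (AttX h)) := by
    refine Finset.filter_congr fun z _ => and_congr_right fun hz => ?_
    have hyz : y.1 ⊔ h ≤ z.1 ⊔ h := sup_le_sup_right hz.1 h
    have hdz : finrank F (z.1 ⊔ h : Submodule F H)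
        = finrank F (y.1 ⊔ h : Submodule F H) + 1 := by
      rw [finrank_sup_attX, finrank_sup_attX, hz.2]
      omega
    constructor
    · intro hUz
      rw [Submodule.eq_of_le_of_finrank_eq (sup_le hyz hUz) (hd.trans hdz.symm)]
      exact le_sup_left
    · intro hzU
      have hle : z.1 ⊔ h ≤ y.1 ⊔ h ⊔ U :=
        sup_le hzU (le_sup_right.trans le_sup_left)
      rw [Submodule.eq_of_le_of_finrank_eq hle (hdz.trans hd.symm)]
      exact le_sup_right
  have hcard := card_covers_le (y := y) (T := y.1 ⊔ h ⊔ U) le_sup_left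
  rw [← hS, hd, finrank_sup_attX] at hcard
  have hne : (Fintype.card F : ℂ) ^ (vdim h y + 1) - (Fintype.card F : ℂ) ^ vdim h y ≠ 0 := by
    rw [pow_succ, ← mul_sub_one]
    have hq : (Fintype.card F : ℂ) ≠ 1 := by
      exact_mod_cast (Fintype.one_lt_card (α := F)).ne'
    exact mul_ne_zero (pow_ne_zero _ (by exact_mod_cast Fintype.card_ne_zero)) (sub_ne_zero.2 hq)
  apply mul_right_cancel₀ hne
  rw [hcard]
  ring

/-- The lowering part in the range where `U` is not below `y + h`. -/
theorem card_covering_eq_mul (hfU : LinearMap.range f ⊔ h ≤ U) {y : AttX h}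
    (hf : LinearMap.range f ≤ y.1 ⊔ h) (hU : ¬ U ≤ y.1 ⊔ h) :
    (#{z : AttX h | AttCovers h y z ∧ U ≤ z.1 ⊔ h} : ℂ)
      = (Fintype.card F : ℂ) ^ finrank F h
        * #{W ∈ hyperplanesAbove (LinearMap.range f ⊔ h) U | W ≤ y.1 ⊔ h} := by
  have hdim := Submodule.finrank_sup_add_finrank_inf_eq (y.1 ⊔ h) U
  by_cases hd : finrank F (y.1 ⊔ h ⊔ U : Submodule F H)
      = finrank F (y.1 ⊔ h : Submodule F H) + 1
  · rw [card_covering_eq_pow hd]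
    have : ({W ∈ hyperplanesAbove (LinearMap.range f ⊔ h) U | W ≤ y.1 ⊔ h} : Finset _)
        = {(y.1 ⊔ h) ⊓ U} := by
      ext W
      rw [Finset.mem_filter, mem_hyperplanesAbove, Finset.mem_singleton]
      constructor
      · rintro ⟨⟨-, hWU, hW⟩, hWy⟩
        exact Submodule.eq_of_le_of_finrank_eq (le_inf hWy hWU) (by omega)
      · rintro rfl
        exact ⟨⟨le_inf (sup_le hf le_sup_right) hfU, inf_le_right, by omega⟩, inf_le_left⟩
    rw [this, Finset.card_singleton, Nat.cast_one, mul_one]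
  · have hlt : y.1 ⊔ h < y.1 ⊔ h ⊔ U := left_lt_sup.2 hU
    have hlt := Submodule.finrank_lt_finrank_of_lt hlt
    rw [Finset.card_eq_zero.2, Finset.card_eq_zero.2, Nat.cast_zero, mul_zero]
    · refine Finset.filter_eq_empty_iff.2 fun W hW hWy => hd ?_
      obtain ⟨-, hWU, hW⟩ := mem_hyperplanesAbove.1 hW
      have := Submodule.finrank_mono (le_inf hWy hWU)
      omega
    · refine Finset.filter_eq_empty_iff.2 fun z _ hz => hd ?_
      have hle : y.1 ⊔ h ⊔ U ≤ z.1 ⊔ h := sup_le (sup_le_sup_right hz.1.1 h) hz.2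
      have := Submodule.finrank_mono hle
      rw [finrank_sup_attX z, hz.1.2] at this
      rw [finrank_sup_attX y] at *
      omega

theorem sum_wave_apply (t : ℂ) (S : Finset (Submodule F H)) (y : AttX h) :
    (∑ W ∈ S, wave ψ f t W) y
      = #{W ∈ S | W ≤ y.1 ⊔ h} * (t ^ vdim h y * phase ψ f y.1) := by
  simp [wave, Finset.sum_apply, ← Finset.sum_filter]

end action

section triangular

variable {h : Submodule F H} {ψ : AddChar F ℂ} {f : h →ₗ[F] H} {U : Submodule F H}

theorem card_sub_one_ne_zero : (Fintype.card F : ℂ) - 1 ≠ 0 :=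
  sub_ne_zero.2 (by exact_mod_cast (Fintype.one_lt_card (α := F)).ne')

/-- The `q`-adjacency matrix acts triangularly on the vectors `wave`. -/
theorem toLin'_Amat_wave (hψ : ψ ≠ 1) {N M r g : ℕ} (hH : finrank F H = N + M)
    (hh : finrank F h = M) (hfU : LinearMap.range f ⊔ h ≤ U)
    (hr : finrank F (LinearMap.range f ⊔ h : Submodule F H) = r + M)
    (hg : finrank F U = r + g + M) {s t θ : ℂ} (hs : s ^ 2 = Fintype.card F)
    (ht : t * s ^ (r + 2 * g + M) = 1)
    (hθ : θ * ((Fintype.card F : ℂ) - 1)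
      = (s ^ (2 * N - (r + 2 * g)) - s ^ (r + 2 * g)) * s ^ M) :
    toLin' (Amat h (Fintype.card F)) (wave ψ f t U) = θ • wave ψ f t U
      + ((Fintype.card F : ℂ) ^ M * t) •
        ∑ W ∈ hyperplanesAbove (LinearMap.range f ⊔ h) U,
          wave ψ f (Fintype.card F * t) W := by
  have ht0 : t ≠ 0 := left_ne_zero_of_mul_eq_one ht
  have hq0 : (Fintype.card F : ℂ) ≠ 0 := by exact_mod_cast Fintype.card_ne_zero
  ext y
  rw [toLin'_Amat_apply, sum_covering_wave hψ, Pi.add_apply, Pi.smul_apply, Pi.smul_apply,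
    sum_wave_apply, smul_eq_mul, smul_eq_mul]
  by_cases hU : U ≤ y.1 ⊔ h
  · have hfilt : ({W ∈ hyperplanesAbove (LinearMap.range f ⊔ h) U | W ≤ y.1 ⊔ h} : Finset _)
        = hyperplanesAbove (LinearMap.range f ⊔ h) U :=
      Finset.filter_true_of_mem fun W hW => (mem_hyperplanesAbove.1 hW).2.1.trans hU
    have hall : ({z | AttCovers h y z ∧ U ≤ z.1 ⊔ h} : Finset (AttX h))
        = ({z | AttCovers h y z ∧ z.1 ≤ ⊤} : Finset (AttX h)) :=
      Finset.filter_congr fun z _ => and_congr_right fun hz =>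
        iff_of_true (hU.trans (sup_le_sup_right hz.1 h)) le_top
    obtain ⟨e, he⟩ := Nat.exists_eq_add_of_le (Submodule.finrank_mono hU)
    obtain ⟨m, hm⟩ := Nat.exists_eq_add_of_le (Submodule.finrank_le (y.1 ⊔ h))
    have hd := finrank_sup_attX y
    have hdown := mul_sum_covered_wave (ψ := ψ) (f := f) (U := U) t y
    have hcov := sum_covered (ψ := ψ) (le_sup_right.trans hfU) (le_sup_left.trans hfU) hU he
    have hup := card_covers_le (y := y) (T := ⊤) le_top
    have hhyp := card_hyperplanesAbove hfU (k := g) (by omega)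
    have hdy : vdim h y = r + g + e := by omega
    have hN : N = r + g + e + m := by omega
    rw [← hall, finrank_top, hH, hh, hdy, hN] at hup
    rw [hfilt, wave, if_pos hU, hdy]
    rw [hdy] at hdown
    rw [show 2 * N - (r + 2 * g) = r + 2 * e + 2 * m by omega] at hθ
    generalize (#{z : AttX h | AttCovers h y z ∧ U ≤ z.1 ⊔ h} : ℂ) = c at *
    generalize (#(hyperplanesAbove (LinearMap.range f ⊔ h) U) : ℂ) = c' at *
    generalize phase ψ f y.1 = p at *
    generalize (∑ z : AttX h with AttCovers h z y, wave ψ f t U z) = σ at *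
    generalize (∑ z : AttX h with AttCovers h z y,
      if U ≤ z.1 ⊔ h then phase ψ f z.1 else 0) = σ' at *
    have hup' : c * ((Fintype.card F : ℂ) - 1)
        = (Fintype.card F : ℂ) ^ M * ((Fintype.card F : ℂ) ^ m - 1) := by
      apply mul_left_cancel₀ (pow_ne_zero (r + g + e) hq0)
      linear_combination hup
    have hc := card_sub_one_ne_zero (F := F)
    rw [← hs] at *
    apply mul_left_cancel₀ (mul_ne_zero ht0 hc)
    have key : ((s ^ 2) ^ e - 1) + t ^ 2 * (s ^ 2) ^ (r + g + e + M) * ((s ^ 2) ^ m - 1)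
        = t * ((s ^ (r + 2 * e + 2 * m) - s ^ (r + 2 * g)) * s ^ M)
          + t ^ 2 * (s ^ 2) ^ (r + g + e + M) * ((s ^ 2) ^ g - 1) := by
      have h1 : t ^ 2 * (s ^ 2) ^ (r + g + e + M) * (s ^ 2) ^ m
          = t * (s ^ (r + 2 * e + 2 * m) * s ^ M) * (t * s ^ (r + 2 * g + M)) := by ring
      have h2 : t ^ 2 * (s ^ 2) ^ (r + g + e + M) * (s ^ 2) ^ g
          = (s ^ 2) ^ e * (t * s ^ (r + 2 * g + M)) ^ 2 := by ring
      have h3 : t * (s ^ (r + 2 * g) * s ^ M) = t * s ^ (r + 2 * g + M) := by ring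
      rw [ht] at h1 h2 h3
      linear_combination h1 - h2 + h3
    linear_combination (s ^ 2 - 1) * hdown + t ^ (r + g + e) * hcov
      + t ^ (r + g + e + 2) * (s ^ 2) ^ (r + g + e) * p * hup'
      + t ^ (r + g + e) * p * key - t ^ (r + g + e + 1) * p * hθ
      - t ^ (r + g + e + 2) * (s ^ 2) ^ (r + g + e + M) * p * hhyp
  · rw [sum_covered_wave_eq_zero t hU, wave, if_neg hU]
    by_cases hf : LinearMap.range f ≤ y.1 ⊔ h
    · rw [card_covering_eq_mul hfU hf hU, hh, mul_pow]
      ring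
    · rw [phase_of_not_le hf]
      ring

end triangular

/-! ### The annihilating polynomial -/

section annihilation

open Polynomial

theorem theta_mul {q : ℕ} (hq : (q : ℂ) - 1 ≠ 0) (N M k : ℕ) :
    ((theta q N M k : ℝ) : ℂ) * ((q : ℂ) - 1)
      = (((√(q : ℝ) : ℝ) : ℂ) ^ (2 * N - k) - ((√(q : ℝ) : ℝ) : ℂ) ^ k)
        * ((√(q : ℝ) : ℝ) : ℂ) ^ M := by
  rw [theta]
  push_cast
  field_simp

theorem aeval_mul_X_sub_C {V : Type*} [AddCommGroup V] [Module ℂ V] (T : End ℂ V) (p : ℂ[X])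
    (c : ℂ) (x : V) : aeval T (p * (X - C c)) x = aeval T p (T x - c • x) := by
  simp [Algebra.algebraMap_eq_smul_one]

variable {h : Submodule F H} {ψ : AddChar F ℂ} {f : h →ₗ[F] H} {N M r : ℕ}

theorem aeval_wave (hψ : ψ ≠ 1) (hH : finrank F H = N + M) (hh : finrank F h = M)
    (hr : finrank F (LinearMap.range f ⊔ h : Submodule F H) = r + M) (g : ℕ)
    {U : Submodule F H} (hfU : LinearMap.range f ⊔ h ≤ U) (hg : finrank F U = r + g + M) :
    aeval (toLin' (Amat h (Fintype.card F)))
      (∏ j ∈ Finset.range (g + 1),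
        (X - C ((theta (Fintype.card F) N M (r + 2 * j) : ℝ) : ℂ)))
      (wave ψ f (((√(Fintype.card F : ℝ) : ℝ) : ℂ) ^ (r + 2 * g + M))⁻¹ U) = 0 := by
  set s : ℂ := ((√(Fintype.card F : ℝ) : ℝ) : ℂ) with hs
  have hs2 : s ^ 2 = Fintype.card F := by
    rw [hs, ← Complex.ofReal_pow, Real.sq_sqrt (Nat.cast_nonneg _), Complex.ofReal_natCast]
  have hs0 : s ≠ 0 := by
    rintro h0
    rw [h0] at hs2
    have : (Fintype.card F : ℂ) ≠ 0 := by exact_mod_cast Fintype.card_ne_zero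
    simp [← hs2] at this
  induction g generalizing U with
  | zero =>
    have hempty : hyperplanesAbove (LinearMap.range f ⊔ h) U = ∅ := by
      refine Finset.eq_empty_of_forall_notMem fun W hW => ?_
      obtain ⟨hKW, -, hd⟩ := mem_hyperplanesAbove.1 hW
      have := Submodule.finrank_mono hKW
      omega
    rw [Finset.prod_range_succ, aeval_mul_X_sub_C,
      toLin'_Amat_wave hψ hH hh hfU hr hg hs2 (inv_mul_cancel₀ (pow_ne_zero _ hs0))
        (theta_mul card_sub_one_ne_zero N M _), hempty]
    simp
  | succ g ih =>
    rw [Finset.prod_range_succ, aeval_mul_X_sub_C,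
      toLin'_Amat_wave hψ hH hh hfU hr hg hs2 (inv_mul_cancel₀ (pow_ne_zero _ hs0))
        (theta_mul card_sub_one_ne_zero N M _), add_sub_cancel_left, map_smul, map_sum,
      Finset.sum_eq_zero, smul_zero]
    intro W hW
    obtain ⟨hKW, -, hd⟩ := mem_hyperplanesAbove.1 hW
    have ht : (Fintype.card F : ℂ) * (s ^ (r + 2 * (g + 1) + M))⁻¹
        = (s ^ (r + 2 * g + M))⁻¹ := by
      rw [← hs2, show r + 2 * (g + 1) + M = 2 + (r + 2 * g + M) by omega, pow_add, mul_inv,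
        mul_inv_cancel_left₀ (pow_ne_zero _ hs0)]
    rw [ht]
    exact ih hKW (by omega)

theorem wave_eq_sum (t : ℂ) (U : Submodule F H) :
    wave ψ f t U = ∑ W : Submodule F H with U ≤ W,
      t ^ (finrank F W - finrank F h) • layer ψ f W := by
  ext y
  rw [Finset.sum_apply, wave]
  simp only [Pi.smul_apply, layer, smul_eq_mul, mul_ite, mul_zero]
  rw [Finset.sum_ite_eq]
  simp [finrank_sup_attX]

/-- The polynomial with simple roots `θ_i`, where `2 i = r, r + 2, …, 2 N - r`. -/
def annPoly (q N M r : ℕ) : ℂ[X] :=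
  ∏ j ∈ Finset.range (N - r + 1), (X - C ((theta q N M (r + 2 * j) : ℝ) : ℂ))

theorem aeval_annPoly_layer (hψ : ψ ≠ 1) (hH : finrank F H = N + M) (hh : finrank F h = M)
    (hr : finrank F (LinearMap.range f ⊔ h : Submodule F H) = r + M)
    {U : Submodule F H} (hfU : LinearMap.range f ⊔ h ≤ U) :
    aeval (toLin' (Amat h (Fintype.card F))) (annPoly (Fintype.card F) N M r)
      (layer ψ f U) = 0 := by
  induction hn : finrank F H - finrank F U using Nat.strong_induction_on generalizing U with
  | _ n ih =>
    obtain ⟨g, hg⟩ := Nat.exists_eq_add_of_le (Submodule.finrank_mono hfU)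
    have hUH := Submodule.finrank_le U
    set s : ℂ := ((√(Fintype.card F : ℝ) : ℝ) : ℂ) with hs
    have hs0 : s ≠ 0 := by
      rw [hs, Complex.ofReal_ne_zero]
      exact (Real.sqrt_pos.2 (by exact_mod_cast Fintype.card_pos)).ne'
    have hwave : aeval (toLin' (Amat h (Fintype.card F))) (annPoly (Fintype.card F) N M r)
        (wave ψ f (s ^ (r + 2 * g + M))⁻¹ U) = 0 := by
      obtain ⟨p, hp⟩ : (∏ j ∈ Finset.range (g + 1),
          (X - C ((theta (Fintype.card F) N M (r + 2 * j) : ℝ) : ℂ)))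
            ∣ annPoly (Fintype.card F) N M r :=
        Finset.prod_dvd_prod_of_subset _ _ _ (Finset.range_mono (by omega))
      rw [hp, mul_comm, map_mul, Module.End.mul_apply,
        aeval_wave hψ hH hh hr g hfU (by omega), map_zero]
    rw [wave_eq_sum, ← Finset.add_sum_erase _ _ (Finset.mem_filter.2
      ⟨Finset.mem_univ U, le_refl U⟩), map_add, map_sum, Finset.sum_eq_zero, add_zero, map_smul,
      smul_eq_zero] at hwave
    · exact hwave.resolve_left (pow_ne_zero _ (inv_ne_zero (pow_ne_zero _ hs0)))
    · intro W hW
      obtain ⟨hne, hW⟩ := Finset.mem_erase.1 hW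
      have hUW : U < W := lt_of_le_of_ne (Finset.mem_filter.1 hW).2 hne.symm
      have h1 := Submodule.finrank_lt_finrank_of_lt hUW
      have h2 := Submodule.finrank_le W
      rw [map_smul, ih _ (by omega) (hfU.trans hUW.le) rfl, smul_zero]

theorem sum_inv_phase_mul (hψ : ψ ≠ 1) [Fintype (h →ₗ[F] H)] {y z : AttX h} (hyz : y ≠ z)
    (hs : y.1 ⊔ h = z.1 ⊔ h) :
    ∑ f : h →ₗ[F] H, (phase ψ f y.1)⁻¹ * phase ψ f z.1 = 0 := by
  have hdim : finrank F y.1 = finrank F z.1 := by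
    have h1 := finrank_sup_attX y
    rw [hs, finrank_sup_attX] at h1
    exact (Nat.add_right_cancel h1).symm
  have hle : ¬ z.1 ≤ y.1 := fun hle =>
    hyz (Subtype.ext (Submodule.eq_of_le_of_finrank_eq hle hdim.symm).symm)
  obtain ⟨v, hvz, hvy⟩ := Set.not_subset.1 hle
  have hv : v ∈ y.1 ⊔ h := hs ▸ le_sup_left (a := z.1) hvz
  obtain ⟨u, hu, b, hb, rfl⟩ := Submodule.mem_sup.1 hv
  have hb0 : (⟨b, hb⟩ : h) ≠ 0 := by
    intro h0
    rw [Subtype.ext_iff] at h0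
    obtain rfl : b = 0 := h0
    exact hvy (by simpa using hu)
  obtain ⟨l, hl⟩ := exists_dual_apply_ne_one hψ hb0
  let g : h →ₗ[F] H := l.smulRight (u + b)
  have hgz : ∀ x, g x - (0 : h →ₗ[F] h) x ∈ z.1 := fun x => by
    simpa [g, ← smul_add] using z.1.smul_mem (l x) hvz
  have hgy : ∀ x, g x - (l.smulRight ⟨b, hb⟩ : h →ₗ[F] h) x ∈ y.1 := fun x => by
    simpa [g] using y.1.smul_mem (l x) hu
  have hc : (phase ψ g y.1)⁻¹ * phase ψ g z.1 ≠ 1 := by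
    rw [phase_eq y.2 hgy, phase_eq z.2 hgz, map_zero, AddChar.map_zero_eq_one, mul_one,
      LinearMap.trace_smulRight]
    exact inv_ne_one.2 hl
  have hsum : ∑ f : h →ₗ[F] H, (phase ψ f y.1)⁻¹ * phase ψ f z.1
      = (∑ f : h →ₗ[F] H, (phase ψ f y.1)⁻¹ * phase ψ f z.1)
        * ((phase ψ g y.1)⁻¹ * phase ψ g z.1) := by
    rw [Finset.sum_mul]
    refine (Equiv.sum_comp (Equiv.addRight g) _).symm.trans ?_
    refine Finset.sum_congr rfl fun f _ => ?_
    rw [Equiv.coe_addRight, phase_add y.2 (range_le_of_sub_mem hgy),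
      phase_add z.2 (range_le_of_sub_mem hgz), mul_inv]
    ring
  have h0 : (∑ f : h →ₗ[F] H, (phase ψ f y.1)⁻¹ * phase ψ f z.1)
      * ((phase ψ g y.1)⁻¹ * phase ψ g z.1 - 1) = 0 := by linear_combination -hsum
  exact (mul_eq_zero.1 h0).resolve_right (sub_ne_zero.2 hc)

theorem single_mem_of_layer_mem (hψ : ψ ≠ 1) (P : Submodule ℂ (AttX h → ℂ))
    (hP : ∀ (f : h →ₗ[F] H) (U : Submodule F H), LinearMap.range f ⊔ h ≤ U → layer ψ f U ∈ P)
    (y : AttX h) : Pi.single y (1 : ℂ) ∈ P := by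
  have : Finite (h →ₗ[F] H) := Module.finite_of_finite F
  have := Fintype.ofFinite (h →ₗ[F] H)
  have hsum : ∑ f : h →ₗ[F] H, (phase ψ f y.1)⁻¹ • layer ψ f (y.1 ⊔ h)
      = (∑ f : h →ₗ[F] H, (phase ψ f y.1)⁻¹ * phase ψ f y.1) • Pi.single y (1 : ℂ) := by
    ext z
    rw [Finset.sum_apply]
    simp only [Pi.smul_apply, smul_eq_mul, layer, mul_ite, mul_zero]
    by_cases hzy : z = y
    · subst hzy
      simp
    · rw [Pi.single_eq_of_ne hzy, mul_zero]
      by_cases hs : z.1 ⊔ h = y.1 ⊔ h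
      · simp only [hs, if_true]
        exact sum_inv_phase_mul hψ (Ne.symm hzy) hs.symm
      · simp [hs]
  have hc : (∑ f : h →ₗ[F] H, (phase ψ f y.1)⁻¹ * phase ψ f y.1) ≠ 0 := by
    have hterm (f : h →ₗ[F] H) : (phase ψ f y.1)⁻¹ * phase ψ f y.1
        = if LinearMap.range f ≤ y.1 ⊔ h then 1 else 0 := by
      split_ifs with hf
      · exact inv_mul_cancel₀ (phase_ne_zero y.2 hf)
      · rw [phase_of_not_le hf, mul_zero]
    simp only [hterm, Finset.sum_boole]
    refine Nat.cast_ne_zero.2 (Finset.card_ne_zero_of_mem (a := 0) ?_)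
    simp
  rw [← Submodule.smul_mem_iff P hc, ← hsum]
  refine P.sum_mem fun f _ => ?_
  by_cases hf : LinearMap.range f ≤ y.1 ⊔ h
  · exact P.smul_mem _ (hP f _ (sup_le hf le_sup_right))
  · rw [phase_of_not_le hf, _root_.inv_zero, zero_smul]
    exact P.zero_mem

theorem aeval_eq_zero (hH : finrank F H = N + M) (hh : finrank F h = M) :
    aeval (toLin' (Amat h (Fintype.card F)))
      (∏ k ∈ Finset.range (2 * N + 1),
        (X - C ((theta (Fintype.card F) N M k : ℝ) : ℂ))) = 0 := by
  obtain ⟨ψ, hψ⟩ := AddChar.exists_apply_ne_zero.2 (one_ne_zero (α := F))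
  replace hψ : ψ ≠ 1 := AddChar.ne_one_iff.2 ⟨1, hψ⟩
  set p := ∏ k ∈ Finset.range (2 * N + 1),
    (X - C ((theta (Fintype.card F) N M k : ℝ) : ℂ)) with hp
  have hker := single_mem_of_layer_mem (h := h) hψ
    (LinearMap.ker (aeval (toLin' (Amat h (Fintype.card F))) p)) fun f U hfU => by
    obtain ⟨r, hr⟩ := Nat.exists_eq_add_of_le'
      (Submodule.finrank_mono (le_sup_right : h ≤ LinearMap.range f ⊔ h))
    rw [hh] at hr
    have hle := Submodule.finrank_le (LinearMap.range f ⊔ h)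
    obtain ⟨p', hp'⟩ : annPoly (Fintype.card F) N M r ∣ p := by
      rw [annPoly, hp, ← Finset.prod_image (s := Finset.range (N - r + 1))
        (g := fun j => r + 2 * j)
        (f := fun k => X - C ((theta (Fintype.card F) N M k : ℝ) : ℂ))
        (fun _ _ _ _ hij => by simpa using hij)]
      refine Finset.prod_dvd_prod_of_subset _ _ _ fun k hk => ?_
      obtain ⟨j, hj, rfl⟩ := Finset.mem_image.1 hk
      rw [Finset.mem_range] at *
      omega
    rw [LinearMap.mem_ker, hp', mul_comm, map_mul, Module.End.mul_apply,
      aeval_annPoly_layer hψ hH hh hr hfU, map_zero]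
  refine LinearMap.pi_ext' fun y => LinearMap.ext_ring ?_
  simpa using hker y

end annihilation

/-! ### Existence of the eigenvalues -/

section existence

open Polynomial

variable {h : Submodule F H} {ψ : AddChar F ℂ} {f : h →ₗ[F] H} {N M r : ℕ}

theorem sum_covered_phase {y : AttX h} {m : ℕ}
    (hr : finrank F (LinearMap.range f ⊔ h : Submodule F H) = r + finrank F h)
    (hy : vdim h y = r + m) :
    (∑ z : AttX h with AttCovers h z y, phase ψ f z.1) * ((Fintype.card F : ℂ) - 1)
      = ((Fintype.card F : ℂ) ^ m - 1) * phase ψ f y.1 := by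
  by_cases hf : LinearMap.range f ≤ y.1 ⊔ h
  · rw [← sum_covered (U := LinearMap.range f ⊔ h) le_sup_right le_sup_left
      (sup_le hf le_sup_right) (by rw [finrank_sup_attX, hy, hr]; omega)]
    congr 1
    refine Finset.sum_congr rfl fun z _ => ?_
    split_ifs with hz
    · rfl
    · exact phase_of_not_le fun hfz => hz (sup_le hfz le_sup_right)
  · rw [phase_of_not_le hf, mul_zero, Finset.sum_eq_zero, zero_mul]
    intro z hz
    refine phase_of_not_le fun hfz => hf (hfz.trans ?_)
    exact sup_le_sup_right (Finset.mem_filter.1 hz).2.1 h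

theorem exists_aeval_prod_layer (ψ : AddChar F ℂ)
    (hr : finrank F (LinearMap.range f ⊔ h : Submodule F H) = r + finrank F h)
    (c : ℕ → ℂ) (S : Finset ℕ) :
    ∃ a : ℂ, a ≠ 0 ∧ ∀ y : AttX h,
      (r + #S < vdim h y → aeval (toLin' (Amat h (Fintype.card F))) (∏ j ∈ S, (X - C (c j)))
        (layer ψ f (LinearMap.range f ⊔ h)) y = 0) ∧
      (vdim h y = r + #S → aeval (toLin' (Amat h (Fintype.card F))) (∏ j ∈ S, (X - C (c j)))
        (layer ψ f (LinearMap.range f ⊔ h)) y = a * phase ψ f y.1) := by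
  induction S using Finset.induction_on with
  | empty =>
    refine ⟨1, one_ne_zero, fun y => ⟨fun hy => ?_, fun hy => ?_⟩⟩ <;>
      rw [Finset.prod_empty, map_one, Module.End.one_apply, layer] <;>
      rw [Finset.card_empty, add_zero] at hy <;>
      have hd := finrank_sup_attX y
    · rw [if_neg]
      intro hyf
      rw [hyf] at hd
      omega
    · rw [one_mul]
      split_ifs with hyf
      · rfl
      · refine (phase_of_not_le fun hf => hyf ?_).symm
        exact (Submodule.eq_of_le_of_finrank_eq (sup_le hf le_sup_right) (by omega)).symm
  | insert j S hj ih =>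
    obtain ⟨a, ha, hx⟩ := ih
    rw [Finset.prod_insert hj, Finset.card_insert_of_notMem hj]
    simp only [map_mul, Module.End.mul_apply]
    generalize aeval (toLin' (Amat h (Fintype.card F))) (∏ j ∈ S, (X - C (c j)))
      (layer ψ f (LinearMap.range f ⊔ h)) = x at *
    have hTx {y : AttX h} (hy : r + #S < vdim h y) :
        aeval (toLin' (Amat h (Fintype.card F))) (X - C (c j)) x y
          = ∑ z : AttX h with AttCovers h z y, x z := by
      have h0 : ∑ z : AttX h with AttCovers h y z, x z = 0 :=
        Finset.sum_eq_zero fun z hz => (hx z).1 <| by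
          rw [(Finset.mem_filter.1 hz).2.2]
          omega
      rw [map_sub, aeval_X, aeval_C, LinearMap.sub_apply, Pi.sub_apply, toLin'_Amat_apply, h0]
      simp [(hx y).1 hy]
    have hq := card_sub_one_ne_zero (F := F)
    refine ⟨a * (((Fintype.card F : ℂ) ^ (#S + 1) - 1) / ((Fintype.card F : ℂ) - 1)),
      mul_ne_zero ha (div_ne_zero (sub_ne_zero.2 ?_) hq), fun y => ⟨fun hy => ?_, fun hy => ?_⟩⟩
    · exact_mod_cast (Nat.one_lt_pow (Nat.succ_ne_zero _) (Fintype.one_lt_card (α := F))).ne'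
    · rw [hTx (by omega)]
      refine Finset.sum_eq_zero fun z hz => (hx z).1 ?_
      have := (Finset.mem_filter.1 hz).2.2
      omega
    · rw [hTx (by omega), Finset.sum_congr rfl fun z hz => (hx z).2 ?_, ← Finset.mul_sum,
        mul_assoc]
      · congr 1
        rw [div_mul_eq_mul_div, eq_div_iff hq, sum_covered_phase hr hy]
      · have := (Finset.mem_filter.1 hz).2.2
        omega

theorem hasEigenvalue_theta (hψ : ψ ≠ 1) (hH : finrank F H = N + M) (hh : finrank F h = M)
    (hr : finrank F (LinearMap.range f ⊔ h : Submodule F H) = r + M) {i : ℕ}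
    (hi : i ≤ N - r) :
    End.HasEigenvalue (toLin' (Amat h (Fintype.card F)))
      ((theta (Fintype.card F) N M (r + 2 * i) : ℝ) : ℂ) := by
  have hle := Submodule.finrank_le (LinearMap.range f ⊔ h)
  have hmem : i ∈ Finset.range (N - r + 1) := Finset.mem_range.2 (by omega)
  obtain ⟨a, ha, hx⟩ := exists_aeval_prod_layer (f := f) (r := r) ψ (by rw [hr, hh])
    (fun j => ((theta (Fintype.card F) N M (r + 2 * j) : ℝ) : ℂ))
    ((Finset.range (N - r + 1)).erase i)
  rw [Finset.card_erase_of_mem hmem, Finset.card_range] at hx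
  have hann := aeval_annPoly_layer hψ hH hh hr le_rfl
  rw [annPoly, ← Finset.mul_prod_erase _ _ hmem, map_mul, Module.End.mul_apply] at hann
  refine End.hasEigenvalue_of_hasEigenvector (x := aeval (toLin' (Amat h (Fintype.card F)))
    (∏ j ∈ (Finset.range (N - r + 1)).erase i,
      (X - C ((theta (Fintype.card F) N M (r + 2 * j) : ℝ) : ℂ)))
    (layer ψ f (LinearMap.range f ⊔ h))) ⟨End.mem_eigenspace_iff.2 ?_, fun h0 => ?_⟩
  · rw [map_sub, aeval_X, aeval_C, LinearMap.sub_apply, sub_eq_zero] at hann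
    simpa [Algebra.algebraMap_eq_smul_one] using hann
  · obtain ⟨w, hw⟩ := Submodule.exists_isCompl h
    have hwd : finrank F w = N := by
      have := Submodule.finrank_add_eq_of_isCompl hw
      omega
    have hy := (hx ⟨w, hw.symm.inf_eq_bot⟩).2 (hwd.trans (by omega))
    rw [h0] at hy
    refine mul_ne_zero ha (phase_ne_zero hw.symm.inf_eq_bot ?_) hy.symm
    rw [hw.symm.sup_eq_top]
    exact le_top

theorem exists_linearMap_finrank_sup (hH : finrank F H = N + M) (hh : finrank F h = M)
    (hN : 0 < N) (hM : 0 < M) (hr : r ≤ 1) :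
    ∃ f : h →ₗ[F] H, finrank F (LinearMap.range f ⊔ h : Submodule F H) = r + M := by
  obtain rfl | rfl : r = 0 ∨ r = 1 := by omega
  · exact ⟨0, by rw [LinearMap.range_zero, bot_sup_eq, hh, zero_add]⟩
  · obtain ⟨v, hv⟩ : ∃ v, v ∉ h := by
      by_contra! hv
      rw [Submodule.eq_top_iff'.2 hv, finrank_top] at hh
      omega
    have : Nontrivial h := Module.nontrivial_of_finrank_pos (R := F) (by omega)
    obtain ⟨b, hb⟩ := exists_ne (0 : h)
    obtain ⟨l, hl⟩ : ∃ l : Dual F h, l b ≠ 0 := by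
      by_contra! hl
      exact hb ((forall_dual_apply_eq_zero_iff F b).1 hl)
    refine ⟨l.smulRight v, ?_⟩
    rw [LinearMap.range_smulRight_apply (by rintro rfl; simp at hl), sup_comm,
      finrank_sup_span hv, hh, add_comm]

end existence

theorem theta_strictAntiOn {q : ℕ} (hq : 1 < q) (N M : ℕ) :
    StrictAntiOn (theta q N M) {k : ℕ | k ≤ 2 * N} := by
  intro k _ l (hl : l ≤ 2 * N) hkl
  have hs : 1 < √(q : ℝ) := by
    rw [Real.lt_sqrt zero_le_one]
    exact_mod_cast (by simpa using hq)
  have h1 : √(q : ℝ) ^ k < √(q : ℝ) ^ l := pow_lt_pow_right₀ hs hkl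
  have h2 : √(q : ℝ) ^ (2 * N - l) < √(q : ℝ) ^ (2 * N - k) :=
    pow_lt_pow_right₀ hs (by omega)
  have h3 : (0 : ℝ) < q - 1 := sub_pos.2 (by exact_mod_cast hq)
  unfold theta
  gcongr

/-- the `q`-adjacency matrix `A`, as an operator on `ℂ^X`, is diagonalizable,
and its set of eigenvalues is exactly `{θ_i : i ∈ [N]}`, a set of `2N+1` distinct real
numbers.  Here `i = k/2 ∈ [N]` is encoded by `k : ℕ`, `k ≤ 2N`. -/
theorem stmt10 (q N M : ℕ) (hq : Fintype.card F = q) (hN : 0 < N) (hM : 0 < M)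
    (h : Submodule F H) (hH : finrank F H = N + M) (hh : finrank F h = M) :
    (⨆ μ : ℂ, Module.End.eigenspace (Matrix.toLin' (Amat h q)) μ) = ⊤ ∧
    {μ : ℂ | Module.End.HasEigenvalue (Matrix.toLin' (Amat h q)) μ}
      = (fun k : ℕ => ((theta q N M k : ℝ) : ℂ)) '' {k : ℕ | k ≤ 2 * N} ∧
    Set.InjOn (theta q N M) {k : ℕ | k ≤ 2 * N} := by
  subst hq
  have hinj := (theta_strictAntiOn (Fintype.one_lt_card (α := F)) N M).injOn
  have hann := aeval_eq_zero (h := h) hH hh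
  obtain ⟨ψ, hψ⟩ := AddChar.exists_apply_ne_zero.2 (one_ne_zero (α := F))
  replace hψ : ψ ≠ 1 := AddChar.ne_one_iff.2 ⟨1, hψ⟩
  refine ⟨?_, Set.Subset.antisymm ?_ ?_, hinj⟩
  · have hsep : (∏ k ∈ Finset.range (2 * N + 1), (Polynomial.X -
        Polynomial.C ((theta (Fintype.card F) N M k : ℝ) : ℂ))).Separable := by
      refine Polynomial.separable_prod_X_sub_C_iff'.2 fun k hk l hl hkl => ?_
      rw [Finset.mem_range, Nat.lt_succ_iff] at hk hl
      exact hinj hk hl (Complex.ofReal_injective hkl)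
    have hss := Module.End.isSemisimple_of_squarefree_aeval_eq_zero hsep.squarefree hann
    rw [← Module.End.iSup_maxGenEigenspace_eq_top (toLin' (Amat h (Fintype.card F)))]
    exact iSup_congr fun μ => (hss.isFinitelySemisimple.maxGenEigenspace_eq_eigenspace μ).symm
  · intro μ hμ
    obtain ⟨x, hx⟩ := Module.End.HasEigenvalue.exists_hasEigenvector hμ
    have h0 := Module.End.aeval_apply_of_hasEigenvector
      (p := ∏ k ∈ Finset.range (2 * N + 1), (Polynomial.X -
        Polynomial.C ((theta (Fintype.card F) N M k : ℝ) : ℂ))) hx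
    rw [hann, LinearMap.zero_apply, eq_comm, smul_eq_zero, or_iff_left hx.2,
      Polynomial.eval_prod, Finset.prod_eq_zero_iff] at h0
    obtain ⟨k, hk, hk0⟩ := h0
    rw [Polynomial.eval_sub, Polynomial.eval_X, Polynomial.eval_C, sub_eq_zero] at hk0
    exact ⟨k, Nat.lt_succ_iff.1 (Finset.mem_range.1 hk), hk0.symm⟩
  · rintro _ ⟨k, (hk : k ≤ 2 * N), rfl⟩
    obtain ⟨f, hf⟩ := exists_linearMap_finrank_sup hH hh hN hM
      (r := k % 2) (by omega)
    have := hasEigenvalue_theta hψ hH hh hf (i := k / 2) (by omega)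
    rwa [Nat.mod_add_div] at this
end
end

section
/- The unital ℂ-subalgebra of Mat_X(ℂ) generated by the q-adjacency matrix A has dimension 2N+1 as a ℂ-vector space. -/
open Module Matrix Finset

noncomputable section

open scoped Classical

variable {F H : Type} [Field F] [Fintype F] [AddCommGroup H] [Module F H]
  [FiniteDimensional F H]

set_option linter.unusedSectionVars false

theorem qProd_comp (s q : ℂ) (a : ℕ) :
    (∏ k ∈ range a, (1 + Polynomial.C (s * q ^ k) * Polynomial.X)).comp
        (Polynomial.C q * Polynomial.X) * (1 + Polynomial.C s * Polynomial.X)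
      = (∏ k ∈ range a, (1 + Polynomial.C (s * q ^ k) * Polynomial.X)) *
        (1 + Polynomial.C (s * q ^ a) * Polynomial.X) := by
  rw [← Finset.prod_range_succ, Finset.prod_range_succ', Polynomial.prod_comp]
  congr 1
  · refine Finset.prod_congr rfl fun k _ => ?_
    simp only [Polynomial.add_comp, Polynomial.one_comp, Polynomial.mul_comp, Polynomial.C_comp,
      Polynomial.X_comp, ← mul_assoc, ← Polynomial.C_mul]
    ring_nf
  · simp

theorem natDegree_qProd_le (s q : ℂ) (a : ℕ) :
    (∏ k ∈ range a, (1 + Polynomial.C (s * q ^ k) * Polynomial.X)).natDegree ≤ a := by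
  refine (Polynomial.natDegree_prod_le _ _).trans ?_
  refine (Finset.sum_le_card_nsmul _ _ 1 fun k _ => ?_).trans (by simp)
  compute_degree

/-- The coefficients of `∏_{k<a} (1 + s q^k X) ∏_{k<b} (1 - s q^k X)` satisfy the three-term
recurrence of the dual `q`-Krawtchouk polynomials. -/
theorem exists_krawtchouk_coeff (s q : ℂ) (a b : ℕ) :
    ∃ f : ℕ → ℂ, f 0 = 1 ∧ (∀ i, a + b < i → f i = 0) ∧
      (q - 1) * f 1 = s * (q ^ a - q ^ b) * f 0 ∧
      ∀ i, (q ^ (i + 2) - 1) * f (i + 2) + s ^ 2 * (q ^ (a + b) - q ^ i) * f i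
        = s * (q ^ a - q ^ b) * f (i + 1) := by
  set P := fun (s : ℂ) (a : ℕ) =>
    ∏ k ∈ range a, (1 + Polynomial.C (s * q ^ k) * Polynomial.X) with hP
  set f := P s a * P (-s) b with hf
  have hdeg : f.natDegree ≤ a + b := Polynomial.natDegree_mul_le.trans
    (add_le_add (natDegree_qProd_le s q a) (natDegree_qProd_le (-s) q b))
  have key : f.comp (Polynomial.C q * Polynomial.X) -
        Polynomial.C (s ^ 2) * (f.comp (Polynomial.C q * Polynomial.X) * Polynomial.X * Polynomial.X)
      = f + Polynomial.C (s * (q ^ a - q ^ b)) * (f * Polynomial.X) -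
        Polynomial.C (s ^ 2 * q ^ (a + b)) * (f * Polynomial.X * Polynomial.X) := by
    have h1 := qProd_comp s q a
    have h2 := qProd_comp (-s) q b
    have h3 : f.comp (Polynomial.C q * Polynomial.X) =
        (P s a).comp (Polynomial.C q * Polynomial.X) *
          (P (-s) b).comp (Polynomial.C q * Polynomial.X) := Polynomial.mul_comp _ _ _
    rw [h3]
    change (P s a).comp _ * _ = P s a * _ at h1
    change (P (-s) b).comp _ * _ = P (-s) b * _ at h2
    have h4 := congrArg₂ (· * ·) h1 h2
    simp only [Polynomial.C_mul, Polynomial.C_neg, Polynomial.C_pow, Polynomial.C_sub] at h4 ⊢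
    rw [hf]
    linear_combination h4
  refine ⟨f.coeff, ?_, fun i hi => Polynomial.coeff_eq_zero_of_natDegree_lt (by omega), ?_, ?_⟩
  · rw [Polynomial.coeff_zero_eq_eval_zero]
    simp [hf, hP, Polynomial.eval_prod]
  · have := congrArg (fun p => Polynomial.coeff p (0 + 1)) key
    simp only [Polynomial.coeff_sub, Polynomial.coeff_add, Polynomial.coeff_C_mul,
      Polynomial.coeff_mul_X, Polynomial.comp_C_mul_X_coeff, Polynomial.mul_coeff_zero,
      Polynomial.coeff_X_zero] at this
    linear_combination this
  · intro i
    have := congrArg (fun p => Polynomial.coeff p (i + 2)) key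
    simp only [Polynomial.coeff_sub, Polynomial.coeff_add, Polynomial.coeff_C_mul,
      Polynomial.coeff_mul_X, Polynomial.comp_C_mul_X_coeff] at this
    linear_combination this

/-- The monic orthogonal polynomials with recurrence coefficients `x`. -/
def recPoly (x : ℕ → ℂ) : ℕ → Polynomial ℂ
  | 0 => 1
  | 1 => Polynomial.X
  | i + 2 => Polynomial.X * recPoly x (i + 1) - Polynomial.C (x i) * recPoly x i

theorem recPoly_monic_natDegree (x : ℕ → ℂ) (i : ℕ) :
    ((recPoly x i).Monic ∧ (recPoly x i).natDegree = i) ∧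
      ((recPoly x (i + 1)).Monic ∧ (recPoly x (i + 1)).natDegree = i + 1) := by
  induction i with
  | zero => simp [recPoly, Polynomial.monic_X]
  | succ i ih =>
    obtain ⟨⟨h1, h2⟩, h3, h4⟩ := ih
    refine ⟨⟨h3, h4⟩, ?_⟩
    have hm : (Polynomial.X * recPoly x (i + 1)).Monic := Polynomial.monic_X.mul h3
    have hd : (Polynomial.X * recPoly x (i + 1)).natDegree = i + 2 := by
      rw [Polynomial.Monic.natDegree_mul Polynomial.monic_X h3, h4, Polynomial.natDegree_X]; omega
    have hlt : (Polynomial.C (x i) * recPoly x i).natDegree <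
        (Polynomial.X * recPoly x (i + 1)).natDegree := by
      refine (Polynomial.natDegree_C_mul_le _ _).trans_lt ?_
      rw [hd, h2]; omega
    refine ⟨?_, ?_⟩
    · exact hm.sub_of_left (Polynomial.degree_lt_degree hlt)
    · change (Polynomial.X * recPoly x (i + 1) - Polynomial.C (x i) * recPoly x i).natDegree = _
      rw [Polynomial.natDegree_sub_eq_left_of_natDegree_lt hlt, hd]

theorem eq_recPoly_eval_mul {x : ℕ → ℂ} {θ : ℂ} {g : ℕ → ℂ} (h1 : g 1 = θ * g 0)
    (h2 : ∀ i, g (i + 2) = θ * g (i + 1) - x i * g i) (i : ℕ) :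
    g i = (recPoly x i).eval θ * g 0 ∧ g (i + 1) = (recPoly x (i + 1)).eval θ * g 0 := by
  induction i with
  | zero => simp [recPoly, h1]
  | succ i ih =>
    refine ⟨ih.2, ?_⟩
    rw [h2, ih.1, ih.2]
    simp [recPoly]
    ring

/-- A nonzero solution of the dual `q`-Krawtchouk recurrence that terminates after `d + 1` steps
has one of the `d + 1` explicit eigenvalues. -/
theorem exists_eq_of_krawtchouk_recurrence {s q θ : ℂ} {d : ℕ}
    (hinj : Set.InjOn (fun a : ℕ => s * (q ^ a - q ^ (d - a))) (range (d + 1)))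
    {g : ℕ → ℂ} (h0 : g 0 ≠ 0) (h1 : g 1 = θ * g 0)
    (h2 : ∀ i, g (i + 2) = θ * g (i + 1) - s ^ 2 * (q ^ (i + 1) - 1) * (q ^ d - q ^ i) * g i)
    (hd : g (d + 1) = 0) :
    ∃ a ≤ d, θ = s * (q ^ a - q ^ (d - a)) := by
  set x : ℕ → ℂ := fun i => s ^ 2 * (q ^ (i + 1) - 1) * (q ^ d - q ^ i) with hx
  obtain ⟨⟨hm, hdeg⟩, -⟩ := recPoly_monic_natDegree x (d + 1)
  have hθ : (recPoly x (d + 1)).eval θ = 0 := by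
    have := (eq_recPoly_eval_mul h1 h2 (d + 1)).1
    rw [hd] at this
    exact (mul_eq_zero.mp this.symm).resolve_right h0
  have hroot : ∀ a ≤ d, (recPoly x (d + 1)).eval (s * (q ^ a - q ^ (d - a))) = 0 := by
    intro a ha
    obtain ⟨f, f0, fd, f1, f2⟩ := exists_krawtchouk_coeff s q a (d - a)
    have hab : a + (d - a) = d := by omega
    rw [hab] at fd f2
    have := (eq_recPoly_eval_mul (x := x) (θ := s * (q ^ a - q ^ (d - a)))
      (g := fun i => f i * ∏ k ∈ range i, (q ^ (k + 1) - 1)) (by simp; linear_combination f1)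
      (fun i => by
        simp only [Finset.prod_range_succ, hx]
        linear_combination (q ^ (i + 1) - 1) * (∏ k ∈ range i, (q ^ (k + 1) - 1)) * f2 i)
      (d + 1)).1
    simp only [fd (d + 1) (by omega), f0, zero_mul, Finset.range_zero, Finset.prod_empty,
      mul_one] at this
    exact this.symm
  by_contra! hne
  have hinj' : Set.InjOn (fun a : ℕ => s * (q ^ a - q ^ (d - a))) (range (d + 1)) := hinj
  set Z := insert θ ((range (d + 1)).image fun a : ℕ => s * (q ^ a - q ^ (d - a))) with hZ
  have hcard : Z.card = d + 2 := by
    rw [hZ, Finset.card_insert_of_notMem, Finset.card_image_of_injOn hinj, Finset.card_range]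
    simp only [Finset.mem_image, Finset.mem_range, not_exists, not_and]
    exact fun a ha h => hne a (by omega) h.symm
  have hsub : Z ⊆ (recPoly x (d + 1)).roots.toFinset := by
    intro t ht
    rw [Multiset.mem_toFinset, Polynomial.mem_roots hm.ne_zero, Polynomial.IsRoot.def]
    rcases Finset.mem_insert.mp ht with rfl | ht
    · exact hθ
    · obtain ⟨a, ha, rfl⟩ := Finset.mem_image.mp ht
      exact hroot a (by simpa [Nat.lt_succ_iff] using ha)
  have := (Finset.card_le_card hsub).trans ((Multiset.toFinset_card_le _).trans
    (Polynomial.card_roots' _))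
  omega

section Ladder
variable {V : Type*} [AddCommGroup V] [Module ℂ V]

/-- In a lowest weight module for the raising and lowering operators, the lowering operator acts
on the ladder `R^i v` by explicit scalars. -/
theorem lowering_pow_raising {R L : Module.End ℂ V} {q Q α β : ℂ}
    (hrel : L * R * R - (q ^ 2 + q) • (R * L * R) + q ^ 3 • (R * R * L) + ((q + 1) * Q) • R = 0)
    (hα : α * (q - 1) ^ 2 = Q) {v : V} (hv : L v = 0)
    (hx : L (R v) = ((q - 1) * (α - β)) • v) (i : ℕ) :
    L ((R ^ (i + 1)) v) = ((q ^ (i + 1) - 1) * (α - β * q ^ i)) • (R ^ i) v := by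
  have hrel' : ∀ w, L (R (R w)) = (q ^ 2 + q) • R (L (R w)) - q ^ 3 • R (R (L w)) -
      ((q + 1) * Q) • R w := by
    intro w
    have := congrArg (fun T : Module.End ℂ V => T w) hrel
    simp only [LinearMap.add_apply, LinearMap.sub_apply, LinearMap.smul_apply,
      Module.End.mul_apply, LinearMap.zero_apply] at this
    rw [← sub_eq_zero, ← this]
    module
  induction i using Nat.strong_induction_on with
  | _ i ih =>
    rcases i with _ | _ | i
    · simpa using hx
    · have : (R ^ (0 + 1 + 1)) v = R (R v) := by simp [pow_succ]
      rw [this, hrel', hx, hv]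
      simp only [map_smul, map_zero, smul_zero, sub_zero, zero_add, pow_one, ← hα]
      module
    · have h1 := ih (i + 1) (by omega)
      have h0 := ih i (by omega)
      have e : ∀ k, (R ^ (k + 1)) v = R ((R ^ k) v) := fun k => by
        rw [pow_succ', Module.End.mul_apply]
      rw [e (i + 2), e (i + 1), hrel', ← e (i + 1), h1, h0]
      simp only [map_smul, ← e, ← hα]
      module

/-- A finite ladder carries explicit eigenvectors of `R + L`. -/
theorem exists_ladder_eigenvector {R L : Module.End ℂ V} {s q : ℂ} {a b : ℕ} (hs : s ≠ 0)
    (hq : ∀ k < a + b, q ^ (a + b) ≠ q ^ k) {v : V} (hv : L v = 0)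
    (hL : ∀ i, L ((R ^ (i + 1)) v) =
      (s ^ 2 * (q ^ (i + 1) - 1) * (q ^ (a + b) - q ^ i)) • (R ^ i) v)
    (htop : (R ^ (a + b + 1)) v = 0) :
    ∃ c : ℕ → ℂ, c 0 = 1 ∧ (R + L) (∑ i ∈ range (a + b + 1), c i • (R ^ i) v) =
      (s * (q ^ a - q ^ b)) • ∑ i ∈ range (a + b + 1), c i • (R ^ i) v := by
  obtain ⟨f, f0, fd, f1, f2⟩ := exists_krawtchouk_coeff s q a b
  set d := a + b with hd
  set π : ℕ → ℂ := fun i => ∏ k ∈ range i, (s ^ 2 * (q ^ d - q ^ k)) with hπ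
  have hπ0 : ∀ i ≤ d, π i ≠ 0 := fun i hi => Finset.prod_ne_zero_iff.mpr fun k hk =>
    mul_ne_zero (pow_ne_zero _ hs) (sub_ne_zero.mpr (hq k (by rw [Finset.mem_range] at hk; omega)))
  have hπs : ∀ i, π (i + 1) = π i * (s ^ 2 * (q ^ d - q ^ i)) := fun i =>
    Finset.prod_range_succ _ _
  refine ⟨fun i => f i / π i, by simp [f0, hπ], ?_⟩
  have e : ∀ k, R ((R ^ k) v) = (R ^ (k + 1)) v := fun k => by
    rw [pow_succ', Module.End.mul_apply]
  have hR : R (∑ i ∈ range (d + 1), (f i / π i) • (R ^ i) v) =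
      ∑ i ∈ range d, (f i / π i) • (R ^ (i + 1)) v := by
    rw [map_sum, Finset.sum_range_succ]
    simp [e, htop]
  have hL' : L (∑ i ∈ range (d + 1), (f i / π i) • (R ^ i) v) =
      ∑ i ∈ range (d + 1), ((q ^ (i + 1) - 1) * f (i + 1) / π i) • (R ^ i) v := by
    rw [map_sum, Finset.sum_range_succ', Finset.sum_range_succ _ d]
    simp only [map_smul, hL, smul_smul, pow_zero, Module.End.one_apply, hv, smul_zero, add_zero,
      fd (d + 1) (by omega), mul_zero, zero_div, zero_smul]
    refine Finset.sum_congr rfl fun i hi => ?_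
    have hi' := Finset.mem_range.mp hi
    have h1 := hπ0 i hi'.le
    have h2 := hπ0 (i + 1) hi'
    congr 1
    rw [hπs] at h2 ⊢
    have h3 := right_ne_zero_of_mul (right_ne_zero_of_mul h2)
    field_simp
  rw [LinearMap.add_apply, hR, hL', Finset.smul_sum, Finset.sum_range_succ',
    Finset.sum_range_succ' _ d, ← add_assoc, ← Finset.sum_add_distrib]
  congr 1
  · refine Finset.sum_congr rfl fun i hi => ?_
    have hi' := Finset.mem_range.mp hi
    have h1 := hπ0 i hi'.le
    have h2 := hπ0 (i + 1) hi'
    rw [← add_smul, smul_smul]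
    congr 1
    rw [mul_div_assoc', ← f2 i, hπs] at *
    have h3 := right_ne_zero_of_mul (right_ne_zero_of_mul h2)
    field_simp
    ring
  · rw [smul_smul]
    congr 1
    simp [f1, hπ]

end Ladder

theorem eq_of_mul_pow_add {Q k m n : ℕ} (hQ : 1 < Q)
    (e : n * Q ^ (k + 1) + m * Q ^ k = m * Q ^ (k + 1) + n * Q ^ k) : n = m := by
  have hpos : (0 : ℤ) < (Q : ℤ) ^ k * (Q - 1) := by
    have : (1 : ℤ) < Q := by exact_mod_cast hQ
    have : (0 : ℤ) < Q - 1 := by omega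
    positivity
  zify at e ⊢
  exact mul_right_cancel₀ hpos.ne' (by linear_combination e)

theorem AttX.ext {h : Submodule F H} {y z : AttX h} (e : y.1 = z.1) : y = z := Subtype.ext e

/-- A subspace of a vertex is a vertex. -/
def AttX.ofLE {h : Submodule F H} (z : AttX h) (w : Submodule F H) (hw : w ≤ z.1) : AttX h :=
  ⟨w, le_bot_iff.mp ((inf_le_inf_right h hw).trans z.2.le)⟩

theorem AttX.eq_of_le {h : Submodule F H} {y z : AttX h} (e : y.1 ≤ z.1)
    (hd : vdim h z ≤ vdim h y) : y = z :=
  AttX.ext (Submodule.eq_of_le_of_finrank_le e hd)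

theorem AttX.inf_sup {h : Submodule F H} {w z : AttX h} (hwz : w.1 ≤ z.1) :
    z.1 ⊓ (w.1 ⊔ h) = w.1 := by
  rw [inf_comm, sup_inf_assoc_of_le h hwz, inf_comm, z.2, sup_bot_eq]

theorem vdim_add_finrank_le (h : Submodule F H) (z : AttX h) :
    vdim h z + finrank F h ≤ finrank F H := by
  have := Submodule.finrank_sup_add_finrank_inf_eq z.1 h
  rw [z.2, finrank_bot, add_zero] at this
  rw [vdim, ← this]
  exact Submodule.finrank_le _

theorem finrank_sup_fixed (h : Submodule F H) (z : AttX h) :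
    finrank F (z.1 ⊔ h : Submodule F H) = vdim h z + finrank F h := by
  have := Submodule.finrank_sup_add_finrank_inf_eq z.1 h
  rwa [z.2, finrank_bot, add_zero] at this

theorem ncard_sdiff_add (U V : Submodule F H) :
    ((U : Set H) \ V).ncard + Fintype.card F ^ finrank F (U ⊓ V : Submodule F H)
      = Fintype.card F ^ finrank F U := by
  have : Finite H := Module.finite_of_finite F
  have e : ∀ W : Submodule F H, (W : Set H).ncard = Fintype.card F ^ finrank F W := fun W => by
    rw [← Nat.card_coe_set_eq, ← Nat.card_eq_fintype_card]
    exact Module.natCard_eq_pow_finrank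
  rw [← e, ← e, Submodule.coe_inf, add_comm]
  exact Set.ncard_inter_add_ncard_sdiff_eq_ncard _ _

/-- Adjoining a vector to a vertex gives a vertex exactly when the vector avoids `w + h`. -/
theorem sup_span_inf_eq_bot_iff {h : Submodule F H} (w : AttX h) {a : H} (ha : a ∉ w.1) :
    (w.1 ⊔ Submodule.span F {a}) ⊓ h = ⊥ ↔ a ∉ w.1 ⊔ h := by
  constructor
  · intro hb hmem
    obtain ⟨y, hy, z, hz, rfl⟩ := Submodule.mem_sup.mp hmem
    have hzs : z ∈ (w.1 ⊔ Submodule.span F {y + z}) ⊓ h := by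
      refine ⟨?_, hz⟩
      have := Submodule.add_mem_sup (neg_mem hy) (Submodule.mem_span_singleton_self (R := F) (y + z))
      rwa [neg_add_cancel_left] at this
    rw [hb, Submodule.mem_bot] at hzs
    exact ha (by simpa [hzs] using hy)
  · intro hn
    rw [eq_bot_iff]
    rintro x ⟨hx, hxh⟩
    obtain ⟨y, hy, z, hz, rfl⟩ := Submodule.mem_sup.mp hx
    obtain ⟨c, rfl⟩ := Submodule.mem_span_singleton.mp hz
    have hc : c = 0 := by
      by_contra hc
      apply hn
      have : a = c⁻¹ • (-y + (y + c • a)) := by simp [smul_smul, inv_mul_cancel₀ hc]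
      rw [this]
      exact Submodule.smul_mem _ _ (Submodule.add_mem_sup (neg_mem hy) hxh)
    subst hc
    rw [← w.2]
    exact ⟨by simpa using hy, hxh⟩

/-- Covers of a vertex, counted by the vectors that generate them. -/
theorem ncard_generators {h : Submodule F H} (w : AttX h) (P : Submodule F H → Prop) :
    {a : H | a ∉ w.1 ⊔ h ∧ P (w.1 ⊔ Submodule.span F {a})}.ncard +
        #{s : AttX h | AttCovers h w s ∧ P s.1} * Fintype.card F ^ vdim h w
      = #{s : AttX h | AttCovers h w s ∧ P s.1} * Fintype.card F ^ (vdim h w + 1) := by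
  have : Finite H := Module.finite_of_finite F
  let _ : Fintype H := Fintype.ofFinite H
  have hgen : ∀ s : AttX h, AttCovers h w s → ∀ a ∈ s.1, a ∉ w.1 →
      w.1 ⊔ Submodule.span F {a} = s.1 := fun s hs a ha haw =>
    Submodule.eq_of_le_of_finrank_le
      (sup_le hs.1 ((Submodule.span_singleton_le_iff_mem _ _).mpr ha))
      (by rw [Submodule.finrank_sup_span_singleton haw]; exact hs.2.le)
  have hout : ∀ s : AttX h, AttCovers h w s → ∀ a ∈ s.1, a ∉ w.1 → a ∉ w.1 ⊔ h := by
    intro s hs a ha haw hn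
    exact haw (AttX.inf_sup hs.1 ▸ ⟨ha, hn⟩ : a ∈ w.1)
  set c := Fintype.card F ^ (vdim h w + 1) - Fintype.card F ^ vdim h w with hc
  have hle : Fintype.card F ^ vdim h w ≤ Fintype.card F ^ (vdim h w + 1) :=
    Nat.pow_le_pow_right Fintype.card_pos (Nat.le_succ _)
  have key := Finset.card_mul_eq_card_mul
    (s := ({a : H | a ∉ w.1 ⊔ h ∧ P (w.1 ⊔ Submodule.span F {a})} : Finset H))
    (t := ({s : AttX h | AttCovers h w s ∧ P s.1} : Finset (AttX h)))
    (fun a s => a ∈ s.1) (m := 1) (n := c)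
    (by
      intro a ha
      simp only [Finset.mem_filter, Finset.mem_univ, true_and] at ha
      have haw : a ∉ w.1 := fun h' => ha.1 (Submodule.mem_sup_left h')
      rw [Finset.card_eq_one]
      obtain ⟨u, hu⟩ : ∃ u : AttX h, u.1 = w.1 ⊔ Submodule.span F {a} :=
        ⟨⟨_, (sup_span_inf_eq_bot_iff w haw).mpr ha.1⟩, rfl⟩
      refine ⟨u, ?_⟩
      ext s
      simp only [Finset.mem_bipartiteAbove, Finset.mem_filter, Finset.mem_univ, true_and,
        Finset.mem_singleton]
      constructor
      · rintro ⟨⟨hs, -⟩, has⟩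
        exact AttX.ext ((hgen s hs a has haw).symm.trans hu.symm)
      · rintro rfl
        refine ⟨⟨⟨hu ▸ le_sup_left, ?_⟩, hu ▸ ha.2⟩,
          hu ▸ Submodule.mem_sup_right (Submodule.mem_span_singleton_self a)⟩
        rw [vdim, hu]
        exact Submodule.finrank_sup_span_singleton haw)
    (by
      intro s hs
      simp only [Finset.mem_filter, Finset.mem_univ, true_and] at hs
      have h1 := ncard_sdiff_add s.1 w.1
      rw [inf_eq_right.mpr hs.1.1] at h1
      have h2 : finrank F s.1 = vdim h w + 1 := hs.1.2
      rw [h2] at h1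
      change _ + Fintype.card F ^ vdim h w = _ at h1
      rw [hc, ← h1, Nat.add_sub_cancel, ← Set.ncard_coe_finset]
      congr 1
      ext a
      simp only [Finset.coe_bipartiteBelow, Finset.mem_filter, Finset.mem_univ, true_and,
        Set.mem_ofPred_eq, Set.mem_sdiff, SetLike.mem_coe]
      constructor
      · rintro ⟨⟨ha, -⟩, has⟩
        exact ⟨has, fun h' => ha (Submodule.mem_sup_left h')⟩
      · rintro ⟨has, haw⟩
        exact ⟨⟨hout s hs.1 a has haw, by rw [hgen s hs.1 a has haw]; exact hs.2⟩, has⟩)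
  rw [mul_one, ← Set.ncard_coe_finset] at key
  simp only [Finset.coe_filter, Finset.mem_univ, true_and] at key
  rw [key, ← mul_add, hc, Nat.sub_add_cancel hle]

/-- The number of covers of a vertex. -/
theorem card_covers (h : Submodule F H) (z : AttX h) :
    #{s : AttX h | AttCovers h z s} * Fintype.card F ^ (vdim h z + 1) +
        Fintype.card F ^ (vdim h z + finrank F h) =
      #{s : AttX h | AttCovers h z s} * Fintype.card F ^ vdim h z +
        Fintype.card F ^ finrank F H := by
  have h1 := ncard_generators z (fun _ => True)
  have h2 := ncard_sdiff_add (⊤ : Submodule F H) (z.1 ⊔ h)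
  rw [top_inf_eq, finrank_top, finrank_sup_fixed] at h2
  have h3 : {a : H | a ∉ z.1 ⊔ h ∧ True} = ((⊤ : Submodule F H) : Set H) \ (z.1 ⊔ h : Submodule F H) := by
    ext; simp
  rw [h3] at h1
  simp only [and_true] at h1
  omega

/-- The number of vertices strictly inside an interval of length two. -/
theorem card_between {h : Submodule F H} {z s : AttX h} (hzs : z.1 ≤ s.1)
    (hd : vdim h s = vdim h z + 2) :
    #{p : AttX h | AttCovers h z p ∧ AttCovers h p s} = Fintype.card F + 1 := by
  have h1 := ncard_generators z (· ≤ s.1)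
  have h2 := ncard_sdiff_add s.1 z.1
  rw [inf_eq_right.mpr hzs] at h2
  have h3 : {a : H | a ∉ z.1 ⊔ h ∧ z.1 ⊔ Submodule.span F {a} ≤ s.1} = (s.1 : Set H) \ z.1 := by
    ext a
    simp only [sup_le_iff, Submodule.span_singleton_le_iff_mem, hzs, true_and, Set.mem_ofPred_eq,
      Set.mem_sdiff, SetLike.mem_coe]
    constructor
    · exact fun ⟨ha, has⟩ => ⟨has, fun h' => ha (Submodule.mem_sup_left h')⟩
    · exact fun ⟨has, haz⟩ => ⟨fun hn => haz (AttX.inf_sup hzs ▸ ⟨has, hn⟩ : a ∈ z.1), has⟩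
  have h4 : ∀ p : AttX h, (AttCovers h z p ∧ p.1 ≤ s.1) ↔ AttCovers h z p ∧ AttCovers h p s :=
    fun p => and_congr_right fun hp => by
      simp only [AttCovers, hd, hp.2, and_true]
  simp only [h3, h4] at h1
  have h5 : finrank F s.1 = vdim h z + 2 := hd
  rw [h5] at h2
  change _ + Fintype.card F ^ vdim h z = _ at h2
  set n := #{p : AttX h | AttCovers h z p ∧ AttCovers h p s}
  exact eq_of_mul_pow_add Fintype.one_lt_card (k := vdim h z)
    (by linear_combination h1.symm + h2)

theorem AttX.sup_inf_eq_bot_of_finrank_inf {h : Submodule F H} {y z : AttX h} {k : ℕ}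
    (hz : vdim h z = k + 1) (hy : vdim h y = k + 2)
    (hw : finrank F (y.1 ⊓ z.1 : Submodule F H) = k) :
    finrank F (y.1 ⊓ (z.1 ⊔ h) : Submodule F H) =
      k + if (y.1 ⊔ z.1) ⊓ h = ⊥ then 0 else 1 := by
  set t := y.1 ⊔ z.1 with ht
  have hz' : finrank F z.1 = k + 1 := hz
  have hy' : finrank F y.1 = k + 2 := hy
  have hft : finrank F t = k + 3 := by
    have := Submodule.finrank_sup_add_finrank_inf_eq y.1 z.1
    rw [← ht, hw, hz', hy'] at this
    omega
  have h1 : (z.1 ⊔ h) ⊓ t = z.1 ⊔ h ⊓ t := sup_inf_assoc_of_le h le_sup_right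
  have h2 : finrank F (z.1 ⊔ h ⊓ t : Submodule F H) = k + 1 + finrank F (h ⊓ t : Submodule F H) := by
    have := Submodule.finrank_sup_add_finrank_inf_eq z.1 (h ⊓ t)
    rw [← inf_assoc, z.2, bot_inf_eq, finrank_bot, hz'] at this
    omega
  have h3 : y.1 ⊓ (z.1 ⊔ h) = y.1 ⊓ (z.1 ⊔ h ⊓ t) := by
    rw [← h1, inf_comm (z.1 ⊔ h) t, ← inf_assoc, inf_eq_left.mpr (le_sup_left : y.1 ≤ t)]
  have h4 : y.1 ⊔ (z.1 ⊔ h ⊓ t) = t := by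
    rw [← sup_assoc]
    exact sup_eq_left.mpr inf_le_right
  have h5 := Submodule.finrank_sup_add_finrank_inf_eq y.1 (z.1 ⊔ h ⊓ t)
  rw [h4, ← h3, h2, hft, hy'] at h5
  have h6 : finrank F (h ⊓ t : Submodule F H) ≤ 1 := by
    have := Submodule.finrank_sup_add_finrank_inf_eq y.1 (h ⊓ t)
    rw [← inf_assoc, y.2, bot_inf_eq, finrank_bot, hy'] at this
    have h7 : finrank F (y.1 ⊔ h ⊓ t : Submodule F H) ≤ finrank F t :=
      Submodule.finrank_mono (sup_le le_sup_left inf_le_right)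
    omega
  split_ifs with hb
  · rw [inf_comm h t, hb, finrank_bot] at h5
    omega
  · have : finrank F (h ⊓ t : Submodule F H) ≠ 0 := fun h0 => hb (by
      rw [inf_comm t h]; exact Submodule.finrank_eq_zero.mp h0)
    omega

/-- Given `w = y ∩ z` of codimension one in `z` and two in `y`, the number of `s` between `w` and
`y` for which `z + s` is again a vertex. -/
theorem card_between_sup {h : Submodule F H} {w y z : AttX h} (hwz : AttCovers h w z)
    (hy : vdim h y = vdim h w + 2) (hw : w.1 = y.1 ⊓ z.1) :
    #{s : AttX h | AttCovers h w s ∧ s.1 ≤ y.1 ∧ (z.1 ⊔ s.1) ⊓ h = ⊥} =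
      Fintype.card F + if (y.1 ⊔ z.1) ⊓ h = ⊥ then 1 else 0 := by
  have h2 := ncard_sdiff_add y.1 (z.1 ⊔ h)
  rw [AttX.sup_inf_eq_bot_of_finrank_inf hwz.2 hy (congrArg (fun U : Submodule F H => finrank F U) hw.symm)] at h2
  have hwy : w.1 ≤ y.1 := hw.le.trans inf_le_left
  have h3 : {a : H | a ∉ w.1 ⊔ h ∧ w.1 ⊔ Submodule.span F {a} ≤ y.1 ∧
      (z.1 ⊔ (w.1 ⊔ Submodule.span F {a})) ⊓ h = ⊥} =
      (y.1 : Set H) \ (z.1 ⊔ h : Submodule F H) := by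
    ext a
    simp only [sup_le_iff, Submodule.span_singleton_le_iff_mem, hwy, true_and, Set.mem_ofPred_eq,
      Set.mem_sdiff, SetLike.mem_coe, ← sup_assoc, sup_eq_left.mpr hwz.1]
    constructor
    · rintro ⟨ha, hay, hb⟩
      have haz : a ∉ z.1 := fun h' => ha (Submodule.mem_sup_left (hw ▸ ⟨hay, h'⟩ : a ∈ w.1))
      exact ⟨hay, (sup_span_inf_eq_bot_iff z haz).mp hb⟩
    · rintro ⟨hay, ha⟩
      exact ⟨fun h' => ha (sup_le_sup_right hwz.1 h h'), hay,
        (sup_span_inf_eq_bot_iff z fun h' => ha (Submodule.mem_sup_left h')).mpr ha⟩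
  have h5 : finrank F y.1 = vdim h w + 2 := hy
  rw [h5] at h2
  change _ + Fintype.card F ^ (vdim h w + _) = _ at h2
  set n := #{s : AttX h | AttCovers h w s ∧ s.1 ≤ y.1 ∧ (z.1 ⊔ s.1) ⊓ h = ⊥} with hn
  have h1 : ((y.1 : Set H) \ (z.1 ⊔ h : Submodule F H)).ncard + n * Fintype.card F ^ vdim h w
      = n * Fintype.card F ^ (vdim h w + 1) := by
    rw [← h3, hn]
    convert ncard_generators w (fun s => s ≤ y.1 ∧ (z.1 ⊔ s) ⊓ h = ⊥)
  refine eq_of_mul_pow_add (Q := Fintype.card F) (k := vdim h w) Fintype.one_lt_card ?_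
  split_ifs at * <;> linear_combination h1.symm + h2

theorem AttCovers.eq_sup {h : Submodule F H} {s z p : AttX h} (hs : AttCovers h s p)
    (hz : AttCovers h z p) (hne : s ≠ z) : p.1 = z.1 ⊔ s.1 := by
  refine (Submodule.eq_of_le_of_finrank_le (sup_le hz.1 hs.1) ?_).symm
  change vdim h p ≤ _
  rw [hz.2]
  by_contra! hlt
  have h1 : z.1 = z.1 ⊔ s.1 :=
    Submodule.eq_of_le_of_finrank_le le_sup_left (Nat.lt_succ_iff.mp hlt)
  exact hne (AttX.eq_of_le (h1 ▸ le_sup_right) (by have := hs.2; have := hz.2; omega))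

theorem AttCovers.eq_inf {h : Submodule F H} {s z w : AttX h} (hs : AttCovers h w s)
    (hz : AttCovers h w z) (hne : s ≠ z) : w.1 = s.1 ⊓ z.1 := by
  refine Submodule.eq_of_le_of_finrank_le (le_inf hs.1 hz.1) ?_
  change _ ≤ vdim h w
  by_contra! hlt
  have h1 : s.1 ⊓ z.1 = s.1 :=
    Submodule.eq_of_le_of_finrank_le inf_le_left (by have := hs.2; unfold vdim at *; omega)
  exact hne (AttX.eq_of_le (h1 ▸ inf_le_right) (by have := hs.2; have := hz.2; omega))

theorem AttCovers.exists_inf {h : Submodule F H} {s z p : AttX h} (hs : AttCovers h s p)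
    (hz : AttCovers h z p) (hne : s ≠ z) : ∃ w, AttCovers h w s ∧ AttCovers h w z := by
  obtain ⟨w, hw⟩ : ∃ w : AttX h, w.1 = s.1 ⊓ z.1 := ⟨z.ofLE _ inf_le_right, rfl⟩
  have h1 := Submodule.finrank_sup_add_finrank_inf_eq s.1 z.1
  have h2 := hs.eq_sup hz hne
  rw [← hw, sup_comm, ← h2] at h1
  change vdim h p + vdim h w = vdim h s + vdim h z at h1
  have h3 := hs.2
  have h4 := hz.2
  exact ⟨w, ⟨hw ▸ inf_le_left, by omega⟩, ⟨hw ▸ inf_le_right, by omega⟩⟩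

theorem AttCovers.exists_sup {h : Submodule F H} {s z w : AttX h} (hs : AttCovers h w s)
    (hz : AttCovers h w z) (hne : s ≠ z) (hb : (z.1 ⊔ s.1) ⊓ h = ⊥) :
    ∃ p, AttCovers h s p ∧ AttCovers h z p := by
  obtain ⟨p, hp⟩ : ∃ p : AttX h, p.1 = z.1 ⊔ s.1 := ⟨⟨_, hb⟩, rfl⟩
  have h1 := Submodule.finrank_sup_add_finrank_inf_eq s.1 z.1
  have h2 := hs.eq_inf hz hne
  rw [← h2, sup_comm, ← hp] at h1
  change vdim h p + vdim h w = vdim h s + vdim h z at h1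
  have h3 := hs.2
  have h4 := hz.2
  exact ⟨p, ⟨hp ▸ le_sup_right, by omega⟩, ⟨hp ▸ le_sup_left, by omega⟩⟩

theorem card_covers_eq_add {h : Submodule F H} {y z : AttX h} (hd : vdim h y = vdim h z + 1) :
    #{p : AttX h | AttCovers h z p} = #{s : AttX h | AttCovers h y s} +
      Fintype.card F ^ (finrank F H - vdim h y) := by
  have h1 := card_covers h z
  have h2 := card_covers h y
  have h3 := vdim_add_finrank_le h y
  have h4 : Fintype.card F ^ finrank F H =
      Fintype.card F ^ (finrank F H - vdim h y) * Fintype.card F ^ (vdim h z + 1) := by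
    rw [← pow_add, ← hd]; congr 1; omega
  rw [hd] at h2
  rw [h4] at h1 h2
  rw [hd]
  rw [hd] at h1 h2
  refine eq_of_mul_pow_add (Q := Fintype.card F) (k := vdim h z + 1) Fintype.one_lt_card ?_
  zify at *
  linear_combination (Fintype.card F : ℤ) * h1 - h2

/-- For `y` of dimension one more than `z`, the number of ways to go up from `z`, down, and up
to `y`, in terms of the common covers and the common subspaces of codimension one. -/
theorem card_up_down_up {h : Submodule F H} {y z : AttX h} (hd : vdim h y = vdim h z + 1) :
    ∑ s : AttX h with AttCovers h s y, #{p : AttX h | AttCovers h s p ∧ AttCovers h z p} =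
      #{s : AttX h | AttCovers h y s ∧ z.1 ≤ s.1} +
        Fintype.card F * #{w : AttX h | AttCovers h w z ∧ w.1 ≤ y.1} +
        if z.1 ≤ y.1 then Fintype.card F ^ (finrank F H - vdim h y) else 0 := by
  set B : Finset (AttX h) :=
    {s : AttX h | AttCovers h s y ∧ s ≠ z ∧ ∃ p, AttCovers h s p ∧ AttCovers h z p} with hB
  have hsum : ∑ s : AttX h with AttCovers h s y, #{p : AttX h | AttCovers h s p ∧ AttCovers h z p} =
      #B + if z.1 ≤ y.1 then #{p : AttX h | AttCovers h z p} else 0 := by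
    have h1 : ∀ s : AttX h, AttCovers h s y → #{p : AttX h | AttCovers h s p ∧ AttCovers h z p} =
        (if s ≠ z ∧ ∃ p, AttCovers h s p ∧ AttCovers h z p then 1 else 0) +
          if s = z then #{p : AttX h | AttCovers h z p} else 0 := by
      intro s hs
      rcases eq_or_ne s z with rfl | hne
      · simp
      · by_cases hp : ∃ p, AttCovers h s p ∧ AttCovers h z p
        · rw [if_pos ⟨hne, hp⟩, if_neg hne, add_zero, Finset.card_eq_one]
          obtain ⟨p, hp1, hp2⟩ := hp
          refine ⟨p, ?_⟩
          ext p'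
          simp only [Finset.mem_filter, Finset.mem_univ, true_and, Finset.mem_singleton]
          constructor
          · exact fun hp' => AttX.ext ((hp'.1.eq_sup hp'.2 hne).trans (hp1.eq_sup hp2 hne).symm)
          · rintro rfl; exact ⟨hp1, hp2⟩
        · rw [if_neg (fun h' => hp h'.2), if_neg hne, Finset.card_eq_zero,
            Finset.filter_eq_empty_iff]
          exact fun p _ h' => hp ⟨p, h'⟩
    rw [Finset.sum_congr rfl fun s hs => h1 s (by simpa using hs), Finset.sum_add_distrib]
    congr 1
    · rw [← Finset.sum_filter, Finset.filter_filter, Finset.sum_const, smul_eq_mul, mul_one]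
    · rw [Finset.sum_ite_eq']
      simp [AttCovers, hd]
  rw [hsum]
  by_cases hzy : z.1 ≤ y.1
  · have hcov : AttCovers h z y := ⟨hzy, hd⟩
    have h1 : ∀ w : AttX h, (AttCovers h w z ∧ w.1 ≤ y.1) ↔ AttCovers h w z := fun w =>
      and_iff_left_of_imp fun hw => hw.1.trans hzy
    have h2 : ∀ s : AttX h, (AttCovers h y s ∧ z.1 ≤ s.1) ↔ AttCovers h y s := fun s =>
      and_iff_left_of_imp fun hs => hzy.trans hs.1
    simp only [if_pos hzy, h1, h2]
    have hBc : #B * 1 = #{w : AttX h | AttCovers h w z} * Fintype.card F := by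
      refine Finset.card_mul_eq_card_mul (fun s w => AttCovers h w s) ?_ ?_
      · intro s hs
        simp only [hB, Finset.mem_filter, Finset.mem_univ, true_and] at hs
        obtain ⟨hsy, hne, p, hp1, hp2⟩ := hs
        obtain ⟨w, hw1, hw2⟩ := hp1.exists_inf hp2 hne
        rw [Finset.card_eq_one]
        refine ⟨w, ?_⟩
        ext w'
        simp only [Finset.mem_bipartiteAbove, Finset.mem_filter, Finset.mem_univ, true_and,
          Finset.mem_singleton]
        constructor
        · exact fun hw' => AttX.ext ((hw'.2.eq_inf hw'.1 hne).trans (hw1.eq_inf hw2 hne).symm)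
        · rintro rfl; exact ⟨hw2, hw1⟩
      · intro w hw
        simp only [Finset.mem_filter, Finset.mem_univ, true_and] at hw
        have h3 := card_between (hw.1.trans hzy) (by rw [hd, hw.2])
        have h4 : B.bipartiteBelow (fun s w => AttCovers h w s) w =
            ({s : AttX h | AttCovers h w s ∧ AttCovers h s y} : Finset (AttX h)).erase z := by
          ext s
          simp only [Finset.mem_bipartiteBelow, hB, Finset.mem_filter, Finset.mem_univ, true_and,
            Finset.mem_erase]
          constructor
          · exact fun ⟨⟨a1, a2, _⟩, a4⟩ => ⟨a2, a4, a1⟩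
          · exact fun ⟨a1, a2, a3⟩ => ⟨⟨a3, a1, y, a3, hcov⟩, a2⟩
        rw [h4, Finset.card_erase_of_mem (by simpa using ⟨hw, hcov⟩), h3, Nat.add_sub_cancel]
    rw [card_covers_eq_add hd]
    linarith
  · simp only [if_neg hzy, add_zero]
    have hny : ∀ s : AttX h, s.1 ≤ y.1 → s ≠ z := by rintro s hs rfl; exact hzy hs
    by_cases hex : ∃ w, AttCovers h w z ∧ w.1 ≤ y.1
    · obtain ⟨w, hwz, hwy⟩ := hex
      have hinf : ∀ w' : AttX h, AttCovers h w' z → w'.1 ≤ y.1 → w'.1 = y.1 ⊓ z.1 := by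
        intro w' hw' hwy'
        refine Submodule.eq_of_le_of_finrank_le (le_inf hwy' hw'.1) ?_
        by_contra! hlt
        have h1 : y.1 ⊓ z.1 = z.1 := Submodule.eq_of_le_of_finrank_le inf_le_right
          (by have := hw'.2; unfold vdim at *; omega)
        exact hzy (h1 ▸ inf_le_left)
      have hw := hinf w hwz hwy
      have h3 : #{w : AttX h | AttCovers h w z ∧ w.1 ≤ y.1} = 1 := by
        rw [Finset.card_eq_one]
        refine ⟨w, ?_⟩
        ext w'
        simp only [Finset.mem_filter, Finset.mem_univ, true_and, Finset.mem_singleton]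
        constructor
        · exact fun hw' => AttX.ext ((hinf w' hw'.1 hw'.2).trans hw.symm)
        · rintro rfl; exact ⟨hwz, hwy⟩
      have h4 : B = ({s : AttX h | AttCovers h w s ∧ s.1 ≤ y.1 ∧
          (z.1 ⊔ s.1) ⊓ h = ⊥} : Finset (AttX h)) := by
        ext s
        simp only [hB, Finset.mem_filter, Finset.mem_univ, true_and]
        constructor
        · rintro ⟨hsy, hne, p, hp1, hp2⟩
          obtain ⟨w', hw1, hw2⟩ := hp1.exists_inf hp2 hne
          have : w' = w := AttX.ext ((hinf w' hw2 (hw1.1.trans hsy.1)).trans hw.symm)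
          exact ⟨this ▸ hw1, hsy.1, by rw [← hp1.eq_sup hp2 hne]; exact p.2⟩
        · rintro ⟨hws, hsy, hb⟩
          have hne := hny s hsy
          exact ⟨⟨hsy, by rw [hd, hwz.2, hws.2]⟩, hne, hws.exists_sup hwz hne hb⟩
      have h5 : #{s : AttX h | AttCovers h y s ∧ z.1 ≤ s.1} =
          if (y.1 ⊔ z.1) ⊓ h = ⊥ then 1 else 0 := by
        have h6 := Submodule.finrank_sup_add_finrank_inf_eq y.1 z.1
        rw [← hw] at h6
        change _ + vdim h w = vdim h y + vdim h z at h6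
        have h7 := hwz.2
        have h8 : ∀ s : AttX h, (AttCovers h y s ∧ z.1 ≤ s.1) ↔ s.1 = y.1 ⊔ z.1 := by
          intro s
          constructor
          · rintro ⟨hs, hzs⟩
            refine (Submodule.eq_of_le_of_finrank_le (sup_le hs.1 hzs) ?_).symm
            have : finrank F s.1 = vdim h y + 1 := hs.2
            omega
          · intro hs
            refine ⟨⟨hs ▸ le_sup_left, ?_⟩, hs ▸ le_sup_right⟩
            rw [vdim, hs]
            omega
        simp only [h8]
        split_ifs with hb
        · obtain ⟨p, hp⟩ : ∃ p : AttX h, p.1 = y.1 ⊔ z.1 := ⟨⟨_, hb⟩, rfl⟩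
          rw [Finset.card_eq_one]
          refine ⟨p, ?_⟩
          ext s
          simp only [Finset.mem_filter, Finset.mem_univ, true_and, Finset.mem_singleton, ← hp]
          exact ⟨AttX.ext, fun e => e ▸ rfl⟩
        · rw [Finset.card_eq_zero, Finset.filter_eq_empty_iff]
          exact fun s _ hs => hb (hs ▸ s.2)
      rw [h3, h4, h5, card_between_sup hwz (by rw [hd, hwz.2]) hw]
      ring
    · have h3 : #{w : AttX h | AttCovers h w z ∧ w.1 ≤ y.1} = 0 := by
        rw [Finset.card_eq_zero, Finset.filter_eq_empty_iff]
        exact fun w _ hw => hex ⟨w, hw⟩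
      have h4 : #B = 0 := by
        rw [Finset.card_eq_zero, Finset.filter_eq_empty_iff]
        rintro s - ⟨hsy, hne, p, hp1, hp2⟩
        obtain ⟨w, hw1, hw2⟩ := hp1.exists_inf hp2 hne
        exact hex ⟨w, hw2, hw1.1.trans hsy.1⟩
      have h5 : #{s : AttX h | AttCovers h y s ∧ z.1 ≤ s.1} = 0 := by
        rw [Finset.card_eq_zero, Finset.filter_eq_empty_iff]
        rintro s - ⟨hs, hzs⟩
        obtain ⟨w, hw⟩ : ∃ w : AttX h, w.1 = y.1 ⊓ z.1 := ⟨y.ofLE _ inf_le_left, rfl⟩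
        have h6 := Submodule.finrank_sup_add_finrank_inf_eq y.1 z.1
        rw [← hw] at h6
        change _ + vdim h w = vdim h y + vdim h z at h6
        have h7 : finrank F (y.1 ⊔ z.1 : Submodule F H) ≤ vdim h s :=
          Submodule.finrank_mono (sup_le hs.1 hzs)
        have h8 : vdim h w < vdim h z := by
          by_contra! hle
          have := AttX.eq_of_le (hw ▸ inf_le_right : w.1 ≤ z.1) hle
          exact hzy (by rw [← this, hw]; exact inf_le_left)
        exact hex ⟨w, ⟨hw ▸ inf_le_right, by have := hs.2; omega⟩, hw ▸ inf_le_left⟩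
      rw [h3, h4, h5]
      simp

theorem Rmat_apply {h : Submodule F H} (y z : AttX h) :
    Rmat h y z = if AttCovers h z y then 1 else 0 := rfl

theorem Lmat_apply {h : Submodule F H} (q : ℕ) (y z : AttX h) :
    Lmat h q y z = if AttCovers h y z then (q : ℂ) ^ vdim h y else 0 := rfl

theorem Lmat_mul_Rmat_mul_Rmat_apply {h : Submodule F H} (q : ℕ) (y z : AttX h) :
    (Lmat h q * Rmat h * Rmat h) y z = (q : ℂ) ^ vdim h y *
      ∑ s : AttX h with AttCovers h y s, (#{p | AttCovers h z p ∧ AttCovers h p s} : ℂ) := by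
  rw [Matrix.mul_assoc, Matrix.mul_apply, Finset.mul_sum, Finset.sum_filter]
  refine Finset.sum_congr rfl fun s _ => ?_
  rw [Lmat_apply, ite_mul, zero_mul, Matrix.mul_apply, Finset.card_filter, Nat.cast_sum]
  congr 2
  refine Finset.sum_congr rfl fun p _ => ?_
  simp only [Rmat_apply]
  split_ifs <;> simp_all

theorem Rmat_mul_Lmat_mul_Rmat_apply {h : Submodule F H} (q : ℕ) (y z : AttX h) :
    (Rmat h * Lmat h q * Rmat h) y z = ∑ s : AttX h with AttCovers h s y,
      (q : ℂ) ^ vdim h s * (#{p | AttCovers h s p ∧ AttCovers h z p} : ℂ) := by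
  rw [Matrix.mul_assoc, Matrix.mul_apply, Finset.sum_filter]
  refine Finset.sum_congr rfl fun s _ => ?_
  rw [Rmat_apply, ite_mul, zero_mul, one_mul, Matrix.mul_apply, Finset.card_filter, Nat.cast_sum,
    Finset.mul_sum]
  congr 1
  refine Finset.sum_congr rfl fun p _ => ?_
  simp only [Rmat_apply, Lmat_apply]
  split_ifs <;> simp_all

theorem Rmat_mul_Rmat_mul_Lmat_apply {h : Submodule F H} (q : ℕ) (y z : AttX h) :
    (Rmat h * Rmat h * Lmat h q) y z = ∑ w : AttX h with AttCovers h w z,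
      (q : ℂ) ^ vdim h w * (#{p | AttCovers h w p ∧ AttCovers h p y} : ℂ) := by
  rw [Matrix.mul_apply, Finset.sum_filter]
  refine Finset.sum_congr rfl fun s _ => ?_
  rw [Lmat_apply, mul_ite, mul_zero, mul_comm, Matrix.mul_apply, Finset.card_filter, Nat.cast_sum]
  congr 2
  refine Finset.sum_congr rfl fun p _ => ?_
  simp only [Rmat_apply]
  split_ifs <;> simp_all

theorem AttCovers.card_between_eq {h : Submodule F H} {z s : AttX h}
    (hd : vdim h s = vdim h z + 2) :
    #{p | AttCovers h z p ∧ AttCovers h p s} = if z.1 ≤ s.1 then Fintype.card F + 1 else 0 := by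
  split_ifs with hzs
  · exact card_between hzs hd
  · rw [Finset.card_eq_zero, Finset.filter_eq_empty_iff]
    exact fun p _ hp => hzs (hp.1.1.trans hp.2.1)

theorem Lmat_Rmat_Rmat_relation (h : Submodule F H) {q : ℕ} (hq : Fintype.card F = q) :
    Lmat h q * Rmat h * Rmat h - ((q : ℂ) ^ 2 + q) • (Rmat h * Lmat h q * Rmat h)
      + (q : ℂ) ^ 3 • (Rmat h * Rmat h * Lmat h q)
      + (((q : ℂ) + 1) * (q : ℂ) ^ finrank F H) • Rmat h = 0 := by
  ext y z
  simp only [Matrix.add_apply, Matrix.sub_apply, Matrix.smul_apply, smul_eq_mul,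
    Lmat_mul_Rmat_mul_Rmat_apply, Rmat_mul_Lmat_mul_Rmat_apply, Rmat_mul_Rmat_mul_Lmat_apply,
    Rmat_apply, Matrix.zero_apply]
  by_cases hd : vdim h y = vdim h z + 1
  · have h1 : ∑ s : AttX h with AttCovers h y s, (#{p | AttCovers h z p ∧ AttCovers h p s} : ℂ) =
        (q + 1) * #{s | AttCovers h y s ∧ z.1 ≤ s.1} := by
      rw [Finset.card_filter, Nat.cast_sum, Finset.mul_sum, Finset.sum_filter]
      refine Finset.sum_congr rfl fun s _ => ?_
      by_cases hs : AttCovers h y s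
      · rw [AttCovers.card_between_eq (by rw [hs.2, hd])]
        simp [hs, hq]
      · simp [hs]
    have h2 : ∑ s : AttX h with AttCovers h s y,
        (q : ℂ) ^ vdim h s * (#{p | AttCovers h s p ∧ AttCovers h z p} : ℂ) =
        (q : ℂ) ^ vdim h z * (#{s | AttCovers h y s ∧ z.1 ≤ s.1} +
          q * #{w | AttCovers h w z ∧ w.1 ≤ y.1} +
          if z.1 ≤ y.1 then (q : ℂ) ^ (finrank F H - vdim h y) else 0) := by
      have := congrArg (Nat.cast : ℕ → ℂ) (card_up_down_up (h := h) hd)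
      rw [hq] at this
      push_cast at this
      rw [← this, Finset.mul_sum]
      refine Finset.sum_congr rfl fun s hs => ?_
      rw [Finset.mem_filter] at hs
      rw [show vdim h s = vdim h z by have := hs.2.2; omega]
    have h3 : (q : ℂ) * ∑ w : AttX h with AttCovers h w z,
        (q : ℂ) ^ vdim h w * (#{p | AttCovers h w p ∧ AttCovers h p y} : ℂ) =
        (q + 1) * (q : ℂ) ^ vdim h z * #{w | AttCovers h w z ∧ w.1 ≤ y.1} := by
      rw [Finset.card_filter, Nat.cast_sum, Finset.mul_sum, Finset.mul_sum, Finset.sum_filter]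
      refine Finset.sum_congr rfl fun s _ => ?_
      by_cases hs : AttCovers h s z
      · rw [AttCovers.card_between_eq (by rw [hd, hs.2]), hq, hs.2]
        by_cases hsy : s.1 ≤ y.1
        · simp [hs, hsy]; ring
        · simp [hs, hsy]
      · simp [hs]
    have h4 : AttCovers h z y ↔ z.1 ≤ y.1 := and_iff_left hd
    have h5 : (q : ℂ) ^ finrank F H =
        (q : ℂ) ^ (finrank F H - vdim h y) * (q : ℂ) ^ vdim h z * q := by
      rw [mul_assoc, ← pow_succ, ← hd, ← pow_add,
        Nat.sub_add_cancel (show vdim h y ≤ finrank F H from Submodule.finrank_le y.1)]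
    simp only [h1, h2, h4, hd, pow_succ, h5]
    rw [show ((q : ℂ) ^ 0 * q * q * q) = q * q * q by ring]
    split_ifs
    · linear_combination q * q * h3
    · linear_combination q * q * h3
  · have h1 : ∀ s : AttX h, AttCovers h y s → #{p | AttCovers h z p ∧ AttCovers h p s} = 0 := by
      intro s hs
      rw [Finset.card_eq_zero, Finset.filter_eq_empty_iff]
      rintro p - ⟨hp1, hp2⟩
      have := hs.2; have := hp1.2; have := hp2.2; omega
    have h2 : ∀ s : AttX h, AttCovers h s y → #{p | AttCovers h s p ∧ AttCovers h z p} = 0 := by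
      intro s hs
      rw [Finset.card_eq_zero, Finset.filter_eq_empty_iff]
      rintro p - ⟨hp1, hp2⟩
      have := hs.2; have := hp1.2; have := hp2.2; omega
    have h3 : ∀ s : AttX h, AttCovers h s z → #{p | AttCovers h s p ∧ AttCovers h p y} = 0 := by
      intro s hs
      rw [Finset.card_eq_zero, Finset.filter_eq_empty_iff]
      rintro p - ⟨hp1, hp2⟩
      have := hs.2; have := hp1.2; have := hp2.2; omega
    rw [Finset.sum_eq_zero, Finset.sum_eq_zero, Finset.sum_eq_zero, if_neg fun hc => hd hc.2]
    · simp
    · intro s hs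
      rw [h3 s (Finset.mem_filter.mp hs).2]; simp
    · intro s hs
      rw [h2 s (Finset.mem_filter.mp hs).2]; simp
    · intro s hs
      rw [h1 s (Finset.mem_filter.mp hs).2]; simp

section Casimir

variable {𝒜 : Type*} [Ring 𝒜] [Algebra ℂ 𝒜] {R L K : 𝒜} {q Q : ℂ}

theorem casimir_commute_raising
    (hrel : L * R * R - (q ^ 2 + q) • (R * L * R) + q ^ 3 • (R * R * L)
      + ((q + 1) * Q) • R = 0) (hK : R * K = q • (K * R)) (hq : q ≠ 0) :
    Commute (((q - 1) • (L * R - q ^ 2 • (R * L)) - ((q + 1) * Q) • 1) * K) R := by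
  have hK' : K * R = q⁻¹ • (R * K) := by rw [hK, smul_smul, inv_mul_cancel₀ hq, one_smul]
  have h1 : ((q - 1) • (L * R - q ^ 2 • (R * L)) - ((q + 1) * Q) • 1) * R =
      q • (R * ((q - 1) • (L * R - q ^ 2 • (R * L)) - ((q + 1) * Q) • 1)) := by
    simp only [mul_sub, sub_mul, smul_sub, mul_smul_comm, smul_mul_assoc, mul_one, one_mul,
      ← mul_assoc]
    linear_combination (norm := module) (q - 1) • hrel
  rw [commute_iff_eq, mul_assoc, hK', mul_smul_comm, ← mul_assoc, h1, smul_mul_assoc, smul_smul,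
    inv_mul_cancel₀ hq, one_smul, mul_assoc]

theorem casimir_commute_lowering
    (hrel : L * L * R - (q ^ 2 + q) • (L * R * L) + q ^ 3 • (R * L * L)
      + ((q + 1) * Q) • L = 0) (hK : K * L = q • (L * K)) :
    Commute (((q - 1) • (L * R - q ^ 2 • (R * L)) - ((q + 1) * Q) • 1) * K) L := by
  have h1 : L * ((q - 1) • (L * R - q ^ 2 • (R * L)) - ((q + 1) * Q) • 1) =
      q • (((q - 1) • (L * R - q ^ 2 • (R * L)) - ((q + 1) * Q) • 1) * L) := by
    simp only [mul_sub, sub_mul, smul_sub, mul_smul_comm, smul_mul_assoc, mul_one, one_mul,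
      ← mul_assoc]
    linear_combination (norm := module) (q - 1) • hrel
  rw [commute_iff_eq, mul_assoc, hK, mul_smul_comm, ← mul_assoc L, h1, smul_mul_assoc, mul_assoc]

end Casimir

section Matrices

variable (h : Submodule F H) {q : ℕ}

/-- The diagonal weight matrix with entries `q ^ (dim y choose 2)`. -/
def weightMat (q : ℕ) : Matrix (AttX h) (AttX h) ℂ :=
  Matrix.diagonal fun y => (q : ℂ) ^ (vdim h y).choose 2

theorem choose_two_succ (k : ℕ) : (k + 1).choose 2 = k.choose 2 + k := by
  rw [Nat.choose_succ_succ' k 1, Nat.choose_one_right, add_comm]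

theorem weightMat_mul_Lmat (q : ℕ) :
    weightMat h q * Lmat h q = (Rmat h)ᵀ * weightMat h q := by
  ext y z
  rw [weightMat, Matrix.diagonal_mul, Matrix.mul_diagonal, Matrix.transpose_apply, Lmat_apply,
    Rmat_apply]
  split_ifs with hc
  · rw [hc.2, choose_two_succ, pow_add, one_mul]
  · simp

theorem weightMat_mul_Rmat (q : ℕ) :
    weightMat h q * Rmat h = (Lmat h q)ᵀ * weightMat h q := by
  rw [← Matrix.transpose_inj]
  have e : (weightMat h q)ᵀ = weightMat h q := Matrix.diagonal_transpose _
  simp only [Matrix.transpose_mul, Matrix.transpose_transpose, e, weightMat_mul_Lmat]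

theorem Lmat_Lmat_Rmat_relation (hq : Fintype.card F = q) :
    Lmat h q * Lmat h q * Rmat h - ((q : ℂ) ^ 2 + q) • (Lmat h q * Rmat h * Lmat h q)
      + (q : ℂ) ^ 3 • (Rmat h * Lmat h q * Lmat h q)
      + (((q : ℂ) + 1) * (q : ℂ) ^ finrank F H) • Lmat h q = 0 := by
  have h0 : (q : ℂ) ≠ 0 := by rw [← hq]; exact_mod_cast Fintype.card_ne_zero
  have hW : IsUnit (weightMat h q) := by
    rw [weightMat, Matrix.isUnit_diagonal, Pi.isUnit_iff]
    exact fun y => (pow_ne_zero _ h0).isUnit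
  have hL := weightMat_mul_Lmat h q
  have hR := weightMat_mul_Rmat h q
  refine hW.mul_left_cancel ?_
  have hrel := congrArg (fun Z => Zᵀ * weightMat h q) (Lmat_Rmat_Rmat_relation h hq)
  simp only [Matrix.transpose_add, Matrix.transpose_sub, Matrix.transpose_smul,
    Matrix.transpose_mul, Matrix.transpose_zero, add_mul, sub_mul, smul_mul_assoc,
    mul_assoc, ← hL, ← hR] at hrel
  simp only [← mul_assoc, ← hL, ← hR] at hrel
  simp only [mul_add, mul_sub, mul_smul_comm, ← mul_assoc]
  rw [zero_mul] at hrel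
  rw [mul_zero]
  convert hrel using 3
  ring

theorem Amat_eq_add (q : ℕ) : Amat h q = Rmat h + Lmat h q := by
  ext y z
  rw [Matrix.add_apply, Rmat_apply, Lmat_apply, Amat]
  split_ifs with h1 h2
  · have := h1.2; have := h2.2; omega
  all_goals simp

theorem Rmat_mul_Astar (hq : (q : ℂ) ≠ 0) :
    Rmat h * Astar h q = (q : ℂ) • (Astar h q * Rmat h) := by
  ext y z
  rw [Astar, Matrix.smul_apply, Matrix.diagonal_mul, Matrix.mul_diagonal, Rmat_apply]
  split_ifs with hc
  · rw [hc.2]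
    push_cast
    rw [neg_add, zpow_add₀ hq, _root_.zpow_neg_one, smul_eq_mul]
    field_simp
  · simp

theorem Astar_mul_Lmat (hq : (q : ℂ) ≠ 0) :
    Astar h q * Lmat h q = (q : ℂ) • (Lmat h q * Astar h q) := by
  ext y z
  rw [Astar, Matrix.smul_apply, Matrix.diagonal_mul, Matrix.mul_diagonal, Lmat_apply]
  split_ifs with hc
  · rw [hc.2]
    push_cast
    rw [neg_add, zpow_add₀ hq, _root_.zpow_neg_one, smul_eq_mul]
    field_simp
  · simp

theorem Estar_mul_Lmat (q i : ℕ) : Estar h i * Lmat h q = Lmat h q * Estar h (i + 1) := by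
  ext y z
  rw [Estar, Estar, Matrix.diagonal_mul, Matrix.mul_diagonal, Lmat_apply]
  split_ifs <;> simp_all [AttCovers]

theorem Estar_succ_mul_Rmat (i : ℕ) : Estar h (i + 1) * Rmat h = Rmat h * Estar h i := by
  ext y z
  rw [Estar, Estar, Matrix.diagonal_mul, Matrix.mul_diagonal, Rmat_apply]
  split_ifs <;> simp_all [AttCovers]

theorem Estar_zero_mul_Rmat : Estar h 0 * Rmat h = 0 := by
  ext y z
  rw [Estar, Matrix.diagonal_mul, Rmat_apply]
  split_ifs <;> simp_all [AttCovers]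

theorem Lmat_mul_Estar_zero (q : ℕ) : Lmat h q * Estar h 0 = 0 := by
  ext y z
  rw [Estar, Matrix.mul_diagonal, Lmat_apply]
  split_ifs <;> simp_all [AttCovers]

theorem Estar_mul_Astar (q i : ℕ) :
    Estar h i * Astar h q = ((q : ℂ) ^ (-(i : ℤ))) • Estar h i := by
  rw [Estar, Astar, Matrix.diagonal_mul_diagonal, ← Matrix.diagonal_smul]
  congr 1
  ext y
  simp only [Pi.smul_apply, smul_eq_mul, ite_mul, mul_ite, one_mul, mul_one, zero_mul, mul_zero]
  split_ifs with e
  · rw [e]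
  · rfl

theorem Estar_eq_zero {N M i : ℕ} (hH : finrank F H = N + M) (hh : finrank F h = M) (hi : N < i) :
    Estar h i = 0 := by
  rw [Estar, ← Matrix.diagonal_zero]
  congr 1
  ext y
  rw [if_neg]
  have := vdim_add_finrank_le h y
  omega

end Matrices

section Eigenvalues

variable {V : Type*} [AddCommGroup V] [Module ℂ V]

theorem exists_eq_of_graded_eigenvector {R L : Module.End ℂ V} {u : ℕ → V} {s q θ : ℂ} {d : ℕ}
    (hinj : Set.InjOn (fun a : ℕ => s * (q ^ a - q ^ (d - a))) (range (d + 1)))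
    (hs : star s = s) (hq : star q = q) {b : V → Module.Dual ℂ V}
    (hb : ∀ (c : ℂ) x y, b (c • x) y = star c * b x y)
    (hbR : ∀ x y, b (R x) y = b x (L y)) (hbL : ∀ x y, b (L x) y = b x (R y))
    (h0 : b (u 0) (u 0) ≠ 0) (hu0 : L (u 1) = θ • u 0)
    (hu : ∀ i, R (u i) + L (u (i + 2)) = θ • u (i + 1))
    (hlow : ∀ i, L ((R ^ (i + 1)) (u 0)) =
      (s ^ 2 * (q ^ (i + 1) - 1) * (q ^ d - q ^ i)) • (R ^ i) (u 0))
    (htop : (R ^ (d + 1)) (u 0) = 0) :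
    ∃ a ≤ d, θ = s * (q ^ a - q ^ (d - a)) := by
  refine exists_eq_of_krawtchouk_recurrence hinj (g := fun i => b ((R ^ i) (u 0)) (u i)) h0 ?_ ?_ ?_
  · change b ((R ^ 1) (u 0)) (u 1) = θ * b (u 0) (u 0)
    rw [pow_one, hbR, hu0, map_smul, smul_eq_mul]
  · intro i
    have e1 := congrArg (b ((R ^ (i + 1)) (u 0))) (hu i)
    have hstar : star (s ^ 2 * (q ^ (i + 1) - 1) * (q ^ d - q ^ i)) =
        s ^ 2 * (q ^ (i + 1) - 1) * (q ^ d - q ^ i) := by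
      simp only [star_mul', star_sub, star_pow, star_one, hs, hq]
    rw [map_add, map_smul, smul_eq_mul, ← hbL, ← hbR, hlow, hb, hstar, ← Module.End.mul_apply,
      ← pow_succ'] at e1
    linear_combination e1
  · rw [htop]
    simpa using hb 0 0 (u (d + 1))

theorem exists_common_eigenvector [FiniteDimensional ℂ V] {f g : Module.End ℂ V} (hfg : Commute f g)
    {θ : ℂ} {u : V} (hu : u ≠ 0) (hf : f u = θ • u) :
    ∃ (ω : ℂ) (w : V), w ≠ 0 ∧ f w = θ • w ∧ g w = ω • w := by
  have hmap : ∀ x ∈ f.eigenspace θ, g x ∈ f.eigenspace θ := by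
    intro x hx
    rw [Module.End.mem_eigenspace_iff] at hx ⊢
    rw [← Module.End.mul_apply, hfg.eq, Module.End.mul_apply, hx, map_smul]
  have : Nontrivial (f.eigenspace θ) :=
    ⟨⟨u, Module.End.mem_eigenspace_iff.mpr hf⟩, 0, fun e => hu (congrArg Subtype.val e)⟩
  obtain ⟨ω, hω⟩ := Module.End.exists_eigenvalue (g.restrict hmap)
  obtain ⟨w, hw⟩ := hω.exists_hasEigenvector
  exact ⟨ω, w, fun e => hw.2 (Subtype.ext e), Module.End.mem_eigenspace_iff.mp w.2,
    congrArg Subtype.val hw.apply_eq_smul⟩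

theorem injOn_pow_sub_pow {q : ℕ} (hq : 1 < q) {s : ℂ} (hs : s ≠ 0) (d : ℕ) :
    Set.InjOn (fun a : ℕ => s * ((q : ℂ) ^ a - (q : ℂ) ^ (d - a))) (range (d + 1)) := by
  have key : ∀ a b : ℕ, a < b → b ≤ d → q ^ a + q ^ (d - b) < q ^ b + q ^ (d - a) := by
    intro a b hab hb
    have h1 : q ^ a < q ^ b := Nat.pow_lt_pow_right hq hab
    have h2 : q ^ (d - b) < q ^ (d - a) := Nat.pow_lt_pow_right hq (by omega)
    omega
  intro a ha b hb e
  have e1 := mul_left_cancel₀ hs e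
  have e2 : q ^ a + q ^ (d - b) = q ^ b + q ^ (d - a) := by
    have : (q : ℂ) ^ a + (q : ℂ) ^ (d - b) = (q : ℂ) ^ b + (q : ℂ) ^ (d - a) := by
      linear_combination e1
    exact_mod_cast this
  simp only [coe_range, Set.mem_Iio] at ha hb
  rcases lt_trichotomy a b with hab | hab | hab
  · exact absurd e2 (key a b hab (by omega)).ne
  · exact hab
  · exact absurd e2 (key b a hab (by omega)).ne'

/-- The scalar `√q ^ e / (q - 1)`. -/
def ladderScale (q e : ℕ) : ℂ := ((√q ^ e / (q - 1) : ℝ) : ℂ)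

theorem ladderScale_sq (q e : ℕ) : ladderScale q e ^ 2 = (q : ℂ) ^ e / ((q : ℂ) - 1) ^ 2 := by
  rw [ladderScale, ← Complex.ofReal_pow, div_pow, ← pow_mul, mul_comm e 2, pow_mul,
    Real.sq_sqrt (Nat.cast_nonneg q)]
  push_cast
  rfl

theorem ladderScale_ne_zero {q : ℕ} (hq : 1 < q) (e : ℕ) : ladderScale q e ≠ 0 := by
  have h1 : (1 : ℝ) < q := by exact_mod_cast hq
  rw [ladderScale, Complex.ofReal_ne_zero]
  exact div_ne_zero (pow_ne_zero _ (Real.sqrt_pos.mpr (by linarith)).ne') (by linarith)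

theorem star_ladderScale (q e : ℕ) : star (ladderScale q e) = ladderScale q e :=
  Complex.conj_ofReal _

end Eigenvalues

section Matrices

variable (h : Submodule F H) {q : ℕ}

/-- The operator on column vectors attached to a matrix. -/
abbrev toOp : Matrix (AttX h) (AttX h) ℂ ≃ₐ[ℂ] Module.End ℂ (AttX h → ℂ) :=
  Matrix.toLinAlgEquiv'

/-- The weighted sesquilinear form, linear in the second argument. -/
def weightForm (q : ℕ) (x : AttX h → ℂ) : Module.Dual ℂ (AttX h → ℂ) :=
  dotProductBilin ℂ ℂ (star x) ∘ₗ toOp h (weightMat h q)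

theorem weightForm_apply (q : ℕ) (x y : AttX h → ℂ) :
    weightForm h q x y = star x ⬝ᵥ weightMat h q *ᵥ y := rfl

theorem weightForm_smul (q : ℕ) (c : ℂ) (x y : AttX h → ℂ) :
    weightForm h q (c • x) y = star c * weightForm h q x y := by
  rw [weightForm_apply, weightForm_apply, star_smul, smul_dotProduct, smul_eq_mul]

theorem star_Rmat_mulVec (x : AttX h → ℂ) : star (Rmat h *ᵥ x) = star x ᵥ* (Rmat h)ᵀ := by
  rw [Matrix.star_mulVec]
  congr 1
  ext y z
  rw [Matrix.conjTranspose_apply, Matrix.transpose_apply, Rmat_apply]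
  split_ifs <;> simp

theorem star_Lmat_mulVec (q : ℕ) (x : AttX h → ℂ) :
    star (Lmat h q *ᵥ x) = star x ᵥ* (Lmat h q)ᵀ := by
  rw [Matrix.star_mulVec]
  congr 1
  ext y z
  rw [Matrix.conjTranspose_apply, Matrix.transpose_apply, Lmat_apply]
  split_ifs <;> simp

theorem weightForm_Rmat (q : ℕ) (x y : AttX h → ℂ) :
    weightForm h q (toOp h (Rmat h) x) y = weightForm h q x (toOp h (Lmat h q) y) := by
  simp only [weightForm_apply, Matrix.toLinAlgEquiv'_apply, star_Rmat_mulVec,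
    ← Matrix.dotProduct_mulVec, Matrix.mulVec_mulVec, weightMat_mul_Lmat]

theorem weightForm_Lmat (q : ℕ) (x y : AttX h → ℂ) :
    weightForm h q (toOp h (Lmat h q) x) y = weightForm h q x (toOp h (Rmat h) y) := by
  simp only [weightForm_apply, Matrix.toLinAlgEquiv'_apply, star_Lmat_mulVec,
    ← Matrix.dotProduct_mulVec, Matrix.mulVec_mulVec, weightMat_mul_Rmat]

theorem weightForm_self_ne_zero (hq : 0 < q) {x : AttX h → ℂ} (hx : x ≠ 0) :
    weightForm h q x x ≠ 0 := by
  have hsum : weightForm h q x x =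
      ((∑ y, ‖x y‖ ^ 2 * (q : ℝ) ^ (vdim h y).choose 2 : ℝ) : ℂ) := by
    rw [weightForm_apply, dotProduct, Complex.ofReal_sum]
    refine Finset.sum_congr rfl fun y _ => ?_
    rw [weightMat, Matrix.mulVec_diagonal, Pi.star_apply, Complex.star_def]
    push_cast
    rw [← Complex.conj_mul']
    ring
  have hpos : (0 : ℝ) < q := by exact_mod_cast hq
  rw [hsum, Complex.ofReal_ne_zero]
  intro e
  rw [Finset.sum_eq_zero_iff_of_nonneg fun y _ => by positivity] at e
  refine hx (funext fun y => ?_)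
  have := e y (Finset.mem_univ y)
  simpa [hpos.ne'] using this

theorem exists_Estar_ne_zero {x : AttX h → ℂ} (hx : x ≠ 0) : ∃ i, toOp h (Estar h i) x ≠ 0 := by
  obtain ⟨y, hy⟩ := Function.ne_iff.mp hx
  refine ⟨vdim h y, fun e => hy ?_⟩
  have := congrFun e y
  rwa [Matrix.toLinAlgEquiv'_apply, Estar, Matrix.mulVec_diagonal, if_pos rfl, one_mul] at this

end Matrices

section Spectrum

variable {h : Submodule F H} {q N M : ℕ}

theorem toOp_mul_apply (P Q : Matrix (AttX h) (AttX h) ℂ) (x : AttX h → ℂ) :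
    toOp h P (toOp h Q x) = toOp h (P * Q) x := by
  rw [map_mul, Module.End.mul_apply]

theorem Estar_Rmat_pow_apply (i r : ℕ) (x : AttX h → ℂ) :
    toOp h (Estar h (r + i)) ((toOp h (Rmat h) ^ i) x) =
      (toOp h (Rmat h) ^ i) (toOp h (Estar h r) x) := by
  induction i with
  | zero => rfl
  | succ i ih =>
    rw [pow_succ', Module.End.mul_apply, Module.End.mul_apply, ← ih, ← add_assoc, toOp_mul_apply,
      toOp_mul_apply, Estar_succ_mul_Rmat]

theorem Rmat_pow_apply_eq_zero (hH : finrank F H = N + M) (hh : finrank F h = M) {i r : ℕ}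
    {x : AttX h → ℂ} (hx : toOp h (Estar h r) x = x) (hi : N < r + i) :
    (toOp h (Rmat h) ^ i) x = 0 := by
  rw [← hx, ← Estar_Rmat_pow_apply, Estar_eq_zero h hH hh hi, map_zero, LinearMap.zero_apply]

theorem Estar_idem (r : ℕ) : Estar h r * Estar h r = Estar h r := by
  rw [Estar, Matrix.diagonal_mul_diagonal]
  congr 1
  ext y
  split_ifs <;> simp

theorem exists_eq_of_Amat_eigenvector (hq : Fintype.card F = q) (hH : finrank F H = N + M)
    (hh : finrank F h = M) {θ : ℂ} {u : AttX h → ℂ} (hu : u ≠ 0)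
    (hA : toOp h (Amat h q) u = θ • u) :
    ∃ d ≤ N, ∃ a ≤ d,
      θ = ladderScale q (N + M - d) * ((q : ℂ) ^ a - (q : ℂ) ^ (d - a)) := by
  have hq1 : 1 < q := hq ▸ Fintype.one_lt_card
  have hq0 : (q : ℂ) ≠ 0 := by exact_mod_cast (by omega : q ≠ 0)
  have hq2 : (q : ℂ) - 1 ≠ 0 := sub_ne_zero.mpr (by exact_mod_cast hq1.ne')
  set R := toOp h (Rmat h) with hR
  set L := toOp h (Lmat h q) with hL
  set E := fun i => toOp h (Estar h i) with hE
  set n := N + M with hn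
  have hEL : ∀ i x, E i (L x) = L (E (i + 1) x) := fun i x => by
    rw [toOp_mul_apply, Estar_mul_Lmat, ← toOp_mul_apply]
  have hER : ∀ i x, E (i + 1) (R x) = R (E i x) := fun i x => by
    rw [toOp_mul_apply, Estar_succ_mul_Rmat, ← toOp_mul_apply]
  have hER0 : ∀ x, E 0 (R x) = 0 := fun x => by
    rw [toOp_mul_apply, Estar_zero_mul_Rmat, map_zero, LinearMap.zero_apply]
  have hLE0 : ∀ x, L (E 0 x) = 0 := fun x => by
    rw [toOp_mul_apply, Lmat_mul_Estar_zero, map_zero, LinearMap.zero_apply]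
  set C := ((q : ℂ) - 1) • (Lmat h q * Rmat h - (q : ℂ) ^ 2 • (Rmat h * Lmat h q))
    - (((q : ℂ) + 1) * (q : ℂ) ^ n) • (1 : Matrix (AttX h) (AttX h) ℂ) with hC
  have hrelR := Lmat_Rmat_Rmat_relation h hq
  have hrelL := Lmat_Lmat_Rmat_relation h hq
  rw [hH] at hrelR hrelL
  have hcomm : Commute (C * Astar h q) (Amat h q) := by
    rw [Amat_eq_add]
    exact (casimir_commute_raising hrelR (Rmat_mul_Astar h hq0) hq0).add_right
      (casimir_commute_lowering hrelL (Astar_mul_Lmat h hq0))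
  obtain ⟨ω, w, hw0, hwA, hwC⟩ :=
    exists_common_eigenvector (hcomm.symm.map (toOp h)) hu hA
  have hRL : R w + L w = θ • w := by
    rw [← hwA, Amat_eq_add, map_add, LinearMap.add_apply]
  have hex : ∃ i, E i w ≠ 0 := exists_Estar_ne_zero h hw0
  obtain ⟨r, hr, hmin⟩ : ∃ r, E r w ≠ 0 ∧ ∀ i < r, E i w = 0 :=
    ⟨Nat.find hex, Nat.find_spec hex, fun i hi => not_not.mp (Nat.find_min hex hi)⟩
  have hstep : ∀ i, R (E i w) + L (E (i + 2) w) = θ • E (i + 1) w := fun i => by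
    rw [← hER, ← hEL, ← map_add, hRL, map_smul]
  have hstep0 : L (E 1 w) = θ • E 0 w := by
    rw [← map_smul, ← hRL, map_add, hER0, zero_add, hEL]
  have hlow : L (E r w) = 0 := by
    rcases r with _ | _ | r
    · exact hLE0 w
    · rw [zero_add, hstep0, hmin 0 one_pos, smul_zero]
    · have := hstep r
      rwa [hmin r (by omega), hmin (r + 1) (by omega), map_zero, zero_add, smul_zero] at this
  have hstepr : L (E (r + 1) w) = θ • E r w := by
    rcases r with _ | r
    · exact hstep0
    · have := hstep r
      rwa [hmin r (by omega), map_zero, zero_add] at this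
  set v := E r w with hv
  have hEv : E r v = v := by rw [hv, toOp_mul_apply, Estar_idem]
  -- the Casimir eigenvalue determines the action of `L * R` on the lowest component
  have hcas : ((q : ℂ) - 1) • L (R v) - (((q : ℂ) + 1) * (q : ℂ) ^ n) • v =
      (ω * (q : ℂ) ^ r) • v := by
    have h1 : Estar h r * C = C * Estar h r := by
      have e1 : Estar h r * (Lmat h q * Rmat h) = Lmat h q * Rmat h * Estar h r := by
        rw [← mul_assoc, Estar_mul_Lmat, mul_assoc, Estar_succ_mul_Rmat, mul_assoc]
      have e2 : Estar h r * (Rmat h * Lmat h q) = Rmat h * Lmat h q * Estar h r := by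
        rcases r with _ | r
        · rw [← mul_assoc, Estar_zero_mul_Rmat, mul_assoc, Lmat_mul_Estar_zero, mul_zero, zero_mul]
        · rw [← mul_assoc, Estar_succ_mul_Rmat, mul_assoc, Estar_mul_Lmat, mul_assoc]
      rw [hC]
      simp only [mul_sub, sub_mul, mul_smul_comm, smul_mul_assoc, mul_one, one_mul, e1, e2]
    have h2 : Estar h r * (C * Astar h q) = ((q : ℂ) ^ (-(r : ℤ))) • (C * Estar h r) := by
      rw [← mul_assoc, h1, mul_assoc, Estar_mul_Astar, mul_smul_comm]
    have h3 := congrArg (E r) hwC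
    rw [toOp_mul_apply, h2, map_smul, map_smul, LinearMap.smul_apply, ← toOp_mul_apply] at h3
    have h4 : toOp h C v = ((q : ℂ) - 1) • L (R v) - (((q : ℂ) + 1) * (q : ℂ) ^ n) • v := by
      simp only [hC, map_sub, map_smul, LinearMap.sub_apply, LinearMap.smul_apply,
        ← toOp_mul_apply, map_one, Module.End.one_apply]
      rw [hlow, map_zero, smul_zero, sub_zero]
    rw [← h4]
    have h5 := congrArg (fun x => (q : ℂ) ^ r • x) h3
    simp only [smul_smul] at h5
    rw [_root_.zpow_neg, zpow_natCast, mul_inv_cancel₀ (pow_ne_zero _ hq0), one_smul] at h5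
    rw [h5, mul_comm]
  set α := (q : ℂ) ^ n / ((q : ℂ) - 1) ^ 2 with hα
  set β := α - (ω * (q : ℂ) ^ r + ((q : ℂ) + 1) * (q : ℂ) ^ n) / ((q : ℂ) - 1) ^ 2 with hβ
  have hx : L (R v) = (((q : ℂ) - 1) * (α - β)) • v := by
    have h1 : ((q : ℂ) - 1) • L (R v) = (ω * (q : ℂ) ^ r + ((q : ℂ) + 1) * (q : ℂ) ^ n) • v := by
      rw [add_smul, ← hcas, sub_add_cancel]
    have h2 := congrArg (fun x => ((q : ℂ) - 1)⁻¹ • x) h1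
    simp only [smul_smul, inv_mul_cancel₀ hq2, one_smul] at h2
    rw [h2, hβ]
    congr 1
    field_simp
    ring
  have hrel : L * R * R - ((q : ℂ) ^ 2 + q) • (R * L * R) + (q : ℂ) ^ 3 • (R * R * L)
      + (((q : ℂ) + 1) * (q : ℂ) ^ n) • R = 0 := by
    simpa only [map_add, map_sub, map_smul, map_mul, map_zero] using congrArg (toOp h) hrelR
  have hpow := lowering_pow_raising (α := α) hrel (div_mul_cancel₀ _ (pow_ne_zero 2 hq2)) hlow hx
  have hex2 : ∃ i, (R ^ (i + 1)) v = 0 := ⟨N, Rmat_pow_apply_eq_zero hH hh hEv (by omega)⟩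
  set d := Nat.find hex2 with hd
  have htop : (R ^ (d + 1)) v = 0 := Nat.find_spec hex2
  have hdN : d ≤ N := Nat.find_min' hex2 (Rmat_pow_apply_eq_zero hH hh hEv (by omega))
  have hdne : (R ^ d) v ≠ 0 := by
    rcases Nat.eq_zero_or_pos d with e | e
    · rw [e]; exact hr
    · have := Nat.find_min hex2 (m := d - 1) (by omega)
      rwa [Nat.sub_add_cancel e] at this
  have hαβ : α = β * (q : ℂ) ^ d := by
    have h1 := hpow d
    rw [htop, map_zero] at h1
    have h2 := (smul_eq_zero.mp h1.symm).resolve_right hdne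
    refine sub_eq_zero.mp ((mul_eq_zero.mp h2).resolve_left (sub_ne_zero.mpr ?_))
    exact_mod_cast (Nat.one_lt_pow (by omega) hq1).ne'
  have hs2 : ladderScale q (n - d) ^ 2 = β := by
    rw [ladderScale_sq]
    refine mul_right_cancel₀ (pow_ne_zero d hq0) ?_
    rw [← hαβ, div_mul_eq_mul_div, ← pow_add, Nat.sub_add_cancel (by omega)]
  refine ⟨d, hdN, exists_eq_of_graded_eigenvector (R := R) (L := L) (u := fun i => E (r + i) w)
    (injOn_pow_sub_pow hq1 (ladderScale_ne_zero hq1 _) d) (star_ladderScale _ _) (star_natCast q)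
    (weightForm_smul h q) (weightForm_Rmat h q) (weightForm_Lmat h q)
    (weightForm_self_ne_zero h (by omega) hr) hstepr (fun i => hstep (r + i)) (fun i => ?_) htop⟩
  change L ((R ^ (i + 1)) v) = _ • (R ^ i) v
  rw [hpow i, hs2, hαβ]
  congr 1
  ring

end Spectrum

section LadderVectors

variable {h : Submodule F H} {q N M : ℕ}

theorem exists_Amat_eigenvector_of_lowest (hq : Fintype.card F = q) (hH : finrank F H = N + M)
    (hh : finrank F h = M) {v : AttX h → ℂ} (hv0 : v ≠ 0) {r a b : ℕ} (hab : r + (a + b) = N)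
    (hEv : toOp h (Estar h r) v = v) (hlow : toOp h (Lmat h q) v = 0)
    (hx : toOp h (Lmat h q) (toOp h (Rmat h) v) =
      (((q : ℂ) ^ (N + M) - (q : ℂ) ^ (N + M - (a + b))) / ((q : ℂ) - 1)) • v) :
    ∃ u ≠ 0, toOp h (Amat h q) u =
      (ladderScale q (N + M - (a + b)) * ((q : ℂ) ^ a - (q : ℂ) ^ b)) • u := by
  have hq1 : 1 < q := hq ▸ Fintype.one_lt_card
  have hq2 : (q : ℂ) - 1 ≠ 0 := sub_ne_zero.mpr (by exact_mod_cast hq1.ne')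
  have hrel := congrArg (toOp h) (Lmat_Rmat_Rmat_relation h hq)
  simp only [map_add, map_sub, map_smul, map_mul, map_zero, hH] at hrel
  set s := ladderScale q (N + M - (a + b)) with hs
  have hsplit : (q : ℂ) ^ (N + M) = (q : ℂ) ^ (N + M - (a + b)) * (q : ℂ) ^ (a + b) := by
    rw [← pow_add, Nat.sub_add_cancel (by omega)]
  have hs2 : s ^ 2 * ((q : ℂ) - 1) ^ 2 = (q : ℂ) ^ (N + M - (a + b)) := by
    rw [hs, ladderScale_sq, div_mul_cancel₀ _ (pow_ne_zero 2 hq2)]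
  have hpow := lowering_pow_raising (α := s ^ 2 * (q : ℂ) ^ (a + b)) (β := s ^ 2) hrel
    (by rw [hsplit, ← hs2]; ring) hlow (by
      rw [hx, hsplit, ← hs2]
      congr 1
      field_simp)
  obtain ⟨c, hc0, hc⟩ := exists_ladder_eigenvector (R := toOp h (Rmat h)) (L := toOp h (Lmat h q))
    (a := a) (b := b) (s := s) (q := q) (ladderScale_ne_zero hq1 _)
    (fun k hk => by exact_mod_cast (Nat.pow_lt_pow_right hq1 hk).ne') hlow
    (fun i => by rw [hpow i]; congr 1; ring)
    (Rmat_pow_apply_eq_zero hH hh hEv (by omega))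
  refine ⟨_, fun e => hv0 ?_, by rw [Amat_eq_add, map_add (toOp h)]; exact hc⟩
  have hproj := congrArg (toOp h (Estar h r)) e
  rw [map_zero, map_sum, Finset.sum_eq_single_of_mem 0 (by simp), hc0, one_smul, pow_zero,
    Module.End.one_apply, hEv] at hproj
  · exact hproj
  · intro i _ hi
    have hz : Estar h r * Estar h (r + i) = 0 := by
      rw [Estar, Estar, Matrix.diagonal_mul_diagonal, ← Matrix.diagonal_zero]
      congr 1
      ext y
      split_ifs <;> first | omega | simp
    rw [map_smul, ← hEv, ← Estar_Rmat_pow_apply, toOp_mul_apply, hz, map_zero, LinearMap.zero_apply, smul_zero]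

theorem Lmat_mul_Rmat_apply (y z : AttX h) :
    (Lmat h q * Rmat h) y z =
      (q : ℂ) ^ vdim h y * (#{s | AttCovers h y s ∧ AttCovers h z s} : ℂ) := by
  rw [Matrix.mul_apply, Finset.card_filter, Nat.cast_sum, Finset.mul_sum]
  refine Finset.sum_congr rfl fun s _ => ?_
  rw [Lmat_apply, Rmat_apply]
  split_ifs <;> simp_all

theorem Lmat_mul_Rmat_apply_self (hq : Fintype.card F = q) (hH : finrank F H = N + M)
    (hh : finrank F h = M) (y : AttX h) :
    (Lmat h q * Rmat h) y y =
      ((q : ℂ) ^ (N + M) - (q : ℂ) ^ (vdim h y + M)) / ((q : ℂ) - 1) := by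
  have hq1 : 1 < q := hq ▸ Fintype.one_lt_card
  have hq2 : (q : ℂ) - 1 ≠ 0 := sub_ne_zero.mpr (by exact_mod_cast hq1.ne')
  have hc := congrArg (Nat.cast : ℕ → ℂ) (card_covers h y)
  rw [hq, hH, hh] at hc
  push_cast at hc
  rw [Lmat_mul_Rmat_apply, eq_div_iff hq2]
  simp only [and_self]
  rw [pow_succ] at hc
  linear_combination hc

theorem toOp_single (P : Matrix (AttX h) (AttX h) ℂ) (z y : AttX h) :
    toOp h P (Pi.single z 1) y = P y z := by
  rw [Matrix.toLinAlgEquiv'_apply, Matrix.mulVec_single_one, Matrix.col_apply]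

theorem exists_Amat_eigenvector_even (hq : Fintype.card F = q) (hH : finrank F H = N + M)
    (hh : finrank F h = M) {a b : ℕ} (hab : a + b = N) :
    ∃ u ≠ 0, toOp h (Amat h q) u =
      (ladderScale q (N + M - (a + b)) * ((q : ℂ) ^ a - (q : ℂ) ^ b)) • u := by
  obtain ⟨o, ho⟩ : ∃ o : AttX h, o.1 = ⊥ := ⟨⟨⊥, bot_inf_eq h⟩, rfl⟩
  have hd : ∀ y : AttX h, vdim h y = 0 ↔ y = o := fun y => by
    rw [vdim, Submodule.finrank_eq_zero]
    exact ⟨fun e => AttX.ext (e.trans ho.symm), fun e => e ▸ ho⟩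
  have hd0 : vdim h o = 0 := (hd o).mpr rfl
  refine exists_Amat_eigenvector_of_lowest (r := 0) (v := Pi.single o 1) hq hH hh
    (by simp) (by omega) ?_ ?_ ?_
  · ext y
    rw [toOp_single, Estar, Matrix.diagonal_apply, Pi.single_apply]
    split_ifs with h1 h2
    · rfl
    · exact absurd (h1 ▸ hd0) h2
    · rfl
  · ext y
    rw [toOp_single, Lmat_apply, if_neg fun hc => ?_]
    · rfl
    · have := hc.2; omega
  · ext y
    rw [toOp_mul_apply, toOp_single, Pi.smul_apply, Pi.single_apply]
    by_cases hy : y = o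
    · rw [hy, Lmat_mul_Rmat_apply_self hq hH hh, hd0, if_pos rfl, smul_eq_mul, mul_one, hab,
        zero_add, Nat.add_sub_cancel_left]
    · rw [if_neg hy, smul_zero, Lmat_mul_Rmat_apply, Finset.card_eq_zero.mpr, Nat.cast_zero,
        mul_zero]
      rw [Finset.filter_eq_empty_iff]
      rintro s - ⟨h1, h2⟩
      have := h1.2; have := h2.2
      exact hy ((hd y).mp (by omega))

theorem AttX.eq_span_of_mem {y : AttX h} (hy : vdim h y = 1) {a : H} (ha : a ≠ 0)
    (hay : a ∈ y.1) : y.1 = Submodule.span F {a} :=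
  (Submodule.eq_of_le_of_finrank_le ((Submodule.span_singleton_le_iff_mem _ _).mpr hay)
    (by rw [finrank_span_singleton ha]; exact hy.le)).symm

theorem card_common_covers {y z : AttX h} (hy : vdim h y = 1) {a : H} (ha : a ≠ 0)
    (hz : z.1 = Submodule.span F {a}) (hay : a ∉ y.1) :
    #{s | AttCovers h y s ∧ AttCovers h z s} = if a ∉ y.1 ⊔ h then 1 else 0 := by
  have hz1 : vdim h z = 1 := by rw [vdim, hz, finrank_span_singleton ha]
  have hsup := Submodule.finrank_sup_add_finrank_inf_eq y.1 (Submodule.span F {a})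
  have hinf : y.1 ⊓ Submodule.span F {a} = ⊥ :=
    disjoint_iff.mp ((Submodule.disjoint_span_singleton' ha).mpr hay)
  rw [hinf, finrank_bot, add_zero, finrank_span_singleton ha] at hsup
  change _ = vdim h y + 1 at hsup
  have key : ∀ s : AttX h, (AttCovers h y s ∧ AttCovers h z s) ↔
      s.1 = y.1 ⊔ Submodule.span F {a} := by
    intro s
    constructor
    · rintro ⟨h1, h2⟩
      refine (Submodule.eq_of_le_of_finrank_le (sup_le h1.1 (hz ▸ h2.1)) ?_).symm
      rw [hsup]
      exact h1.2.le
    · intro hs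
      have hs1 : vdim h s = vdim h y + 1 := by rw [vdim, hs, hsup]
      exact ⟨⟨hs ▸ le_sup_left, hs1⟩, by rw [hz, hs]; exact le_sup_right, by rw [hs1, hy, hz1]⟩
  simp only [key]
  by_cases hb : a ∉ y.1 ⊔ h
  · rw [if_pos hb]
    obtain ⟨p, hp⟩ : ∃ p : AttX h, p.1 = y.1 ⊔ Submodule.span F {a} :=
      ⟨⟨_, (sup_span_inf_eq_bot_iff y hay).mpr hb⟩, rfl⟩
    rw [Finset.card_eq_one]
    refine ⟨p, ?_⟩
    ext s
    simp only [Finset.mem_filter, Finset.mem_univ, true_and, Finset.mem_singleton, ← hp]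
    exact ⟨AttX.ext, fun e => e ▸ rfl⟩
  · rw [if_neg hb, Finset.card_eq_zero, Finset.filter_eq_empty_iff]
    exact fun s _ hs => hb ((sup_span_inf_eq_bot_iff y hay).mp (hs ▸ s.2))

theorem exists_Amat_eigenvector_odd (hq : Fintype.card F = q) (hH : finrank F H = N + M)
    (hh : finrank F h = M) (hN : 0 < N) (hM : 0 < M) {a b : ℕ} (hab : a + b + 1 = N) :
    ∃ u ≠ 0, toOp h (Amat h q) u =
      (ladderScale q (N + M - (a + b)) * ((q : ℂ) ^ a - (q : ℂ) ^ b)) • u := by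
  obtain ⟨x, hx⟩ : ∃ x, x ∉ h := by
    by_contra! hc
    have : h = ⊤ := (Submodule.eq_top_iff').mpr hc
    rw [this, finrank_top] at hh
    omega
  obtain ⟨t, ht, ht0⟩ : ∃ t ∈ h, t ≠ 0 := by
    refine Submodule.exists_mem_ne_zero_of_ne_bot fun e => ?_
    rw [e, finrank_bot] at hh
    omega
  have line : ∀ z ∉ h, ∃ l : AttX h, l.1 = Submodule.span F {z} := fun z hz =>
    ⟨⟨_, disjoint_iff.mp ((Submodule.disjoint_span_singleton'
      (show z ≠ 0 from fun e => hz (e ▸ h.zero_mem))).mpr hz).symm⟩, rfl⟩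
  have hy : x + t ∉ h := fun hc => hx ((h.add_mem_iff_left ht).mp hc)
  have hx0 : x ≠ 0 := fun e => hx (e ▸ h.zero_mem)
  have hy0 : x + t ≠ 0 := fun e => hy (e ▸ h.zero_mem)
  obtain ⟨l₁, hl₁⟩ := line x hx
  obtain ⟨l₂, hl₂⟩ := line (x + t) hy
  have hd₁ : vdim h l₁ = 1 := by rw [vdim, hl₁, finrank_span_singleton hx0]
  have hd₂ : vdim h l₂ = 1 := by rw [vdim, hl₂, finrank_span_singleton hy0]
  have hmem₁ : x ∈ l₁.1 := hl₁ ▸ Submodule.mem_span_singleton_self x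
  have hmem₂ : x + t ∈ l₂.1 := hl₂ ▸ Submodule.mem_span_singleton_self _
  have hdisj : ∀ l : AttX h, x ∈ l.1 → x + t ∉ l.1 := by
    intro l h1 h2
    have h3 : t ∈ l.1 ⊓ h := ⟨(l.1.add_mem_iff_right h1).mp h2, ht⟩
    rw [l.2, Submodule.mem_bot] at h3
    exact ht0 h3
  have hne : l₁ ≠ l₂ := fun e => hdisj l₁ hmem₁ (e ▸ hmem₂)
  have hiff : ∀ l : AttX h, x + t ∈ l.1 ⊔ h ↔ x ∈ l.1 ⊔ h := fun l =>
    Submodule.add_mem_iff_left _ (Submodule.mem_sup_right ht)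
  refine exists_Amat_eigenvector_of_lowest (r := 1) (v := Pi.single l₁ 1 - Pi.single l₂ 1)
    hq hH hh ?_ (by omega) ?_ ?_ ?_
  · intro e
    have := congrFun e l₁
    simp [hne] at this
  · ext y
    rw [map_sub, Pi.sub_apply, Pi.sub_apply, toOp_single, toOp_single, Estar,
      Matrix.diagonal_apply, Matrix.diagonal_apply, Pi.single_apply, Pi.single_apply]
    congr 1
    · split_ifs with h1 h2
      · rfl
      · exact absurd (h1 ▸ hd₁) h2
      · rfl
    · split_ifs with h1 h2
      · rfl
      · exact absurd (h1 ▸ hd₂) h2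
      · rfl
  · have hcov : ∀ y l : AttX h, vdim h l = 1 → (AttCovers h y l ↔ vdim h y = 0) := by
      intro y l hl
      constructor
      · intro hc
        have := hc.2
        omega
      · intro h0
        have h1 : y.1 = ⊥ := Submodule.finrank_eq_zero.mp h0
        exact ⟨h1.le.trans bot_le, by omega⟩
    ext y
    rw [map_sub, Pi.sub_apply, toOp_single, toOp_single, Lmat_apply, Lmat_apply]
    simp only [hcov y l₁ hd₁, hcov y l₂ hd₂, sub_self, Pi.zero_apply]
  · have hzero : ∀ y l : AttX h, vdim h y = 1 → ∀ z : H, z ≠ 0 → l.1 = Submodule.span F {z} →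
        z ∉ y.1 → z ∈ y.1 ⊔ h → (Lmat h q * Rmat h) y l = 0 := by
      intro y l hy z hz hl hzy hzs
      rw [Lmat_mul_Rmat_apply, card_common_covers hy hz hl hzy, if_neg (not_not.mpr hzs),
        Nat.cast_zero, mul_zero]
    have hpow : N + M - (a + b) = 1 + M := by omega
    ext y
    rw [map_sub, map_sub, Pi.sub_apply, toOp_mul_apply, toOp_mul_apply, toOp_single, toOp_single,
      Pi.smul_apply, Pi.sub_apply, Pi.single_apply, Pi.single_apply, hpow, smul_eq_mul]
    by_cases h1 : y = l₁
    · subst h1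
      rw [if_pos rfl, if_neg hne, Lmat_mul_Rmat_apply_self hq hH hh, hd₁,
        hzero y l₂ hd₁ _ hy0 hl₂ (hdisj y hmem₁)
          ((hiff y).mpr (Submodule.mem_sup_left hmem₁))]
      ring
    by_cases h2 : y = l₂
    · subst h2
      rw [if_pos rfl, if_neg h1, Lmat_mul_Rmat_apply_self hq hH hh, hd₂,
        hzero y l₁ hd₂ _ hx0 hl₁ (fun hc => hdisj y hc hmem₂)
          ((hiff y).mp (Submodule.mem_sup_left hmem₂))]
      ring
    rw [if_neg h1, if_neg h2, sub_zero, mul_zero]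
    by_cases hy1 : vdim h y = 1
    · have n1 : x ∉ y.1 := fun hc => h1 (AttX.ext ((AttX.eq_span_of_mem hy1 hx0 hc).trans hl₁.symm))
      have n2 : x + t ∉ y.1 := fun hc =>
        h2 (AttX.ext ((AttX.eq_span_of_mem hy1 hy0 hc).trans hl₂.symm))
      rw [Lmat_mul_Rmat_apply, Lmat_mul_Rmat_apply, card_common_covers hy1 hx0 hl₁ n1,
        card_common_covers hy1 hy0 hl₂ n2]
      simp only [hiff, sub_self]
    · have hz : ∀ l : AttX h, vdim h l = 1 → (Lmat h q * Rmat h) y l = 0 := by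
        intro l hl
        rw [Lmat_mul_Rmat_apply, Finset.card_eq_zero.mpr, Nat.cast_zero, mul_zero]
        rw [Finset.filter_eq_empty_iff]
        rintro s - ⟨e1, e2⟩
        have := e1.2; have := e2.2
        omega
      rw [hz l₁ hd₁, hz l₂ hd₂, sub_zero]

end LadderVectors

section Diagonalization

open Polynomial

theorem aeval_eq_zero_of_isHermitian_conj {n : Type*} [Fintype n] [DecidableEq n]
    {A S T : Matrix n n ℂ} (hTS : T * S = 1) (hST : S * T = 1) (hB : (S * A * T).IsHermitian)
    {p : ℂ[X]} (hp : ∀ (θ : ℂ) (u : n → ℂ), u ≠ 0 → A *ᵥ u = θ • u → p.eval θ = 0) :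
    aeval A p = 0 := by
  have hzero : ∀ j, (aeval A p * T) *ᵥ ⇑(hB.eigenvectorBasis j) = 0 := by
    intro j
    set w := ⇑(hB.eigenvectorBasis j) with hw
    have hw0 : w ≠ 0 := fun e => hB.eigenvectorBasis.toBasis.ne_zero j (by
      rw [OrthonormalBasis.coe_toBasis]
      ext i
      exact congrFun e i)
    have hT0 : T *ᵥ w ≠ 0 := fun e => hw0 (by
      rw [← Matrix.one_mulVec w, ← hST, ← Matrix.mulVec_mulVec, e, Matrix.mulVec_zero])
    have hA : A *ᵥ (T *ᵥ w) = ((hB.eigenvalues j : ℝ) : ℂ) • (T *ᵥ w) := by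
      have e := congrArg (T *ᵥ ·) (hB.mulVec_eigenvectorBasis j)
      simp only [← hw, Matrix.mulVec_mulVec, ← mul_assoc, hTS, one_mul] at e
      rw [Matrix.mulVec_mulVec, e, Matrix.mulVec_smul]
      rfl
    have hev : Module.End.HasEigenvector (Matrix.toLinAlgEquiv' A)
        ((hB.eigenvalues j : ℝ) : ℂ) (T *ᵥ w) :=
      ⟨Module.End.mem_eigenspace_iff.mpr hA, hT0⟩
    have e := Module.End.aeval_apply_of_hasEigenvector (p := p) hev
    rw [hp _ _ hT0 hA, zero_smul, ← AlgEquiv.coe_toAlgHom, Polynomial.aeval_algHom_apply] at e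
    rw [← Matrix.mulVec_mulVec]
    exact e
  have hlin : Matrix.toLinAlgEquiv' (aeval A p * T) ∘ₗ (WithLp.linearEquiv 2 ℂ (n → ℂ)).toLinearMap
      = 0 :=
    hB.eigenvectorBasis.toBasis.ext fun j => by
      rw [OrthonormalBasis.coe_toBasis]
      exact hzero j
  have hmat : aeval A p * T = 0 := by
    refine (Matrix.toLinAlgEquiv' (R := ℂ) (n := n)).injective (LinearMap.ext fun x => ?_)
    rw [map_zero]
    exact LinearMap.congr_fun hlin (WithLp.toLp 2 x)
  rw [← mul_one (aeval A p), ← hTS, ← mul_assoc, hmat, zero_mul]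

theorem finrank_adjoin_eq_card {𝒜 ι : Type*} [Ring 𝒜] [Algebra ℂ 𝒜] [Fintype ι] {A : 𝒜}
    {θ : ι → ℂ} (hθ : Function.Injective θ)
    (hA : ∀ p : ℂ[X], aeval A p = 0 ↔ ∀ i, p.eval (θ i) = 0) :
    finrank ℂ (Algebra.adjoin ℂ {A}) = Fintype.card ι := by
  classical
  set ev : ℂ[X] →ₗ[ℂ] (ι → ℂ) := LinearMap.pi fun i => Polynomial.leval (θ i) with hev
  have hsurj : Function.Surjective ev := fun r =>
    ⟨Lagrange.interpolate Finset.univ θ r, funext fun i =>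
      Lagrange.eval_interpolate_at_node r hθ.injOn (Finset.mem_univ i)⟩
  set f := (aeval A : ℂ[X] →ₐ[ℂ] 𝒜).toLinearMap with hf
  have hker : LinearMap.ker f = LinearMap.ker ev := by
    ext p
    rw [LinearMap.mem_ker, LinearMap.mem_ker]
    exact (hA p).trans funext_iff.symm
  have e := (f.quotKerEquivRange.symm.trans (Submodule.quotEquivOfEq _ _ hker)).trans
    (ev.quotKerEquivOfSurjective hsurj)
  have h1 : Subalgebra.toSubmodule (Algebra.adjoin ℂ {A}) = LinearMap.range f := by
    rw [Algebra.adjoin_singleton_eq_range_aeval]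
    rfl
  rw [← Module.finrank_fintype_fun_eq_card ℂ, ← e.finrank_eq, ← h1]
  rfl

/-- The eigenvalue `√q ^ n * (√q ^ m - √q ^ (-m)) / (q - 1)`. -/
def attEigenvalue (q n : ℕ) (m : ℤ) : ℂ :=
  ((√q ^ n * (√q ^ m - √q ^ (-m)) / (q - 1) : ℝ) : ℂ)

theorem attEigenvalue_injective {q : ℕ} (hq : 1 < q) (n : ℕ) :
    Function.Injective (attEigenvalue q n) := by
  have h1 : (1 : ℝ) < q := by exact_mod_cast hq
  have h2 : 1 < √(q : ℝ) := Real.lt_sqrt_of_sq_lt (by simpa using h1)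
  refine Complex.ofReal_injective.comp (StrictMono.injective fun a b hab => ?_)
  have h3 := zpow_lt_zpow_right₀ h2 hab
  have h4 := zpow_lt_zpow_right₀ h2 (neg_lt_neg hab)
  refine div_lt_div_of_pos_right (mul_lt_mul_of_pos_left (by linarith) (by positivity))
    (by linarith)

theorem ladderScale_mul_eq_attEigenvalue {q n a b : ℕ} (hq : 1 < q) (hab : a + b ≤ n) :
    ladderScale q (n - (a + b)) * ((q : ℂ) ^ a - (q : ℂ) ^ b) = attEigenvalue q n (a - b) := by
  have h1 : (1 : ℝ) < q := by exact_mod_cast hq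
  have h2 : √(q : ℝ) ≠ 0 := (Real.sqrt_pos.mpr (by linarith)).ne'
  have h3 : (q : ℝ) = √q ^ 2 := (Real.sq_sqrt (by linarith)).symm
  have h4 : ((q : ℂ) ^ a - (q : ℂ) ^ b) = (((√q ^ 2) ^ a - (√q ^ 2) ^ b : ℝ) : ℂ) := by
    rw [← h3]
    push_cast
    rfl
  rw [ladderScale, attEigenvalue, h4, ← Complex.ofReal_mul]
  congr 1
  obtain ⟨c, rfl⟩ := Nat.exists_eq_add_of_le hab
  rw [Nat.add_sub_cancel_left, neg_sub, zpow_sub₀ h2, zpow_sub₀ h2]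
  simp only [zpow_natCast]
  have h5 : (q : ℝ) - 1 ≠ 0 := by linarith
  field_simp
  ring

end Diagonalization

section Dimension

variable (h : Submodule F H) {q : ℕ}

theorem isHermitian_conj_Amat (hq : 0 < q) :
    (Matrix.diagonal (fun y : AttX h => (√(q : ℝ) : ℂ) ^ (vdim h y).choose 2) * Amat h q *
      Matrix.diagonal
        (fun y : AttX h => ((√(q : ℝ) : ℂ) ^ (vdim h y).choose 2)⁻¹)).IsHermitian := by
  have h1 : (0 : ℝ) < q := by exact_mod_cast hq
  have h2 : (√(q : ℝ) : ℂ) ≠ 0 := Complex.ofReal_ne_zero.mpr (Real.sqrt_pos.mpr h1).ne'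
  have h3 : (q : ℂ) = (√(q : ℝ) : ℂ) ^ 2 := by
    rw [← Complex.ofReal_pow, Real.sq_sqrt h1.le, Complex.ofReal_natCast]
  have key : ∀ y z : AttX h, (Matrix.diagonal
      (fun y : AttX h => (√(q : ℝ) : ℂ) ^ (vdim h y).choose 2) * Amat h q *
      Matrix.diagonal (fun y : AttX h => ((√(q : ℝ) : ℂ) ^ (vdim h y).choose 2)⁻¹)) y z =
      ((if AttCovers h z y then √(q : ℝ) ^ vdim h z else
        if AttCovers h y z then √(q : ℝ) ^ vdim h y else 0 : ℝ) : ℂ) := by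
    intro y z
    rw [Matrix.mul_diagonal, Matrix.diagonal_mul, Amat]
    split_ifs with hc hc'
    · rw [hc.2, choose_two_succ, pow_add, Complex.ofReal_pow]
      field_simp
    · rw [hc'.2, choose_two_succ, pow_add, Complex.ofReal_pow, h3]
      field_simp
      ring
    · simp
  ext y z
  rw [Matrix.conjTranspose_apply, key, key, Complex.star_def, Complex.conj_ofReal]
  congr 1
  split_ifs with h1 h2
  · have := h1.2; have := h2.2; omega
  all_goals rfl

end Dimension

/-- the unital `ℂ`-subalgebra of `Mat_X(ℂ)` generated by the
`q`-adjacency matrix `A` has dimension `2N+1`. -/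
theorem stmt11 (q N M : ℕ) (hq : Fintype.card F = q) (hN : 0 < N) (hM : 0 < M)
    (h : Submodule F H) (hH : finrank F H = N + M) (hh : finrank F h = M) :
    finrank ℂ (Algebra.adjoin ℂ {Amat h q} : Subalgebra ℂ (Matrix (AttX h) (AttX h) ℂ))
      = 2 * N + 1 := by
  have hq1 : 1 < q := hq ▸ Fintype.one_lt_card
  have hsqrt : (√(q : ℝ) : ℂ) ≠ 0 :=
    Complex.ofReal_ne_zero.mpr (Real.sqrt_pos.mpr (by exact_mod_cast (by omega : 0 < q))).ne'
  have hexists : ∀ i : Finset.Icc (-N : ℤ) N, ∃ u ≠ 0,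
      toOp h (Amat h q) u = attEigenvalue q (N + M) i • u := by
    rintro ⟨m, hm⟩
    rw [Finset.mem_Icc] at hm
    rcases Int.emod_two_eq_zero_or_one (m + N) with hpar | hpar
    · obtain ⟨a, ha⟩ := Int.eq_ofNat_of_zero_le (show 0 ≤ (m + N) / 2 by omega)
      obtain ⟨b, hb⟩ := Int.eq_ofNat_of_zero_le (show 0 ≤ N - (m + N) / 2 by omega)
      obtain ⟨u, hu, e⟩ := exists_Amat_eigenvector_even hq hH hh (a := a) (b := b) (by omega)
      refine ⟨u, hu, ?_⟩
      rw [e, ladderScale_mul_eq_attEigenvalue hq1 (by omega)]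
      congr 2
      change (a : ℤ) - b = m
      omega
    · obtain ⟨a, ha⟩ := Int.eq_ofNat_of_zero_le (show 0 ≤ (m + N) / 2 by omega)
      obtain ⟨b, hb⟩ := Int.eq_ofNat_of_zero_le (show 0 ≤ N - 1 - (m + N) / 2 by omega)
      obtain ⟨u, hu, e⟩ := exists_Amat_eigenvector_odd hq hH hh hN hM (a := a) (b := b) (by omega)
      refine ⟨u, hu, ?_⟩
      rw [e, ladderScale_mul_eq_attEigenvalue hq1 (by omega)]
      congr 2
      change (a : ℤ) - b = m
      omega
  rw [finrank_adjoin_eq_card (ι := Finset.Icc (-N : ℤ) N)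
    (θ := fun i => attEigenvalue q (N + M) i)
    ((attEigenvalue_injective hq1 _).comp Subtype.val_injective), Fintype.card_coe, Int.card_Icc]
  · omega
  intro p
  constructor
  · intro hp i
    obtain ⟨u, hu, e⟩ := hexists i
    have hev : (toOp h (Amat h q)).HasEigenvector (attEigenvalue q (N + M) i) u :=
      ⟨Module.End.mem_eigenspace_iff.mpr e, hu⟩
    have e1 := Module.End.aeval_apply_of_hasEigenvector (p := p) hev
    rw [← AlgEquiv.coe_toAlgHom, Polynomial.aeval_algHom_apply, hp, map_zero,
      LinearMap.zero_apply] at e1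
    exact (smul_eq_zero.mp e1.symm).resolve_right hu
  · intro hp
    refine aeval_eq_zero_of_isHermitian_conj ?_ ?_ (isHermitian_conj_Amat h (by omega)) ?_
    · rw [Matrix.diagonal_mul_diagonal, ← Matrix.diagonal_one]
      congr 1
      ext y
      exact inv_mul_cancel₀ (pow_ne_zero _ hsqrt)
    · rw [Matrix.diagonal_mul_diagonal, ← Matrix.diagonal_one]
      congr 1
      ext y
      exact mul_inv_cancel₀ (pow_ne_zero _ hsqrt)
    · intro θ u hu hA
      obtain ⟨d, hd, a, ha, rfl⟩ := exists_eq_of_Amat_eigenvector hq hH hh hu hA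
      obtain ⟨b, rfl⟩ := Nat.exists_eq_add_of_le ha
      rw [Nat.add_sub_cancel_left, ladderScale_mul_eq_attEigenvalue hq1 (by omega)]
      exact hp ⟨(a : ℤ) - b, Finset.mem_Icc.mpr (by omega)⟩
end
end

section
/- For each i ∈ [N], the matrix S maps the eigenspace of A for the eigenvalue θ_i onto the eigenspace of A for the eigenvalue θ_{N−i}; that is, S·(eigenspace of A for θ_i) = eigenspace of A for θ_{N−i}. -/
open Module Matrix Finset

noncomputable section

open scoped Classical

variable {F H : Type} [Field F] [Fintype F] [AddCommGroup H] [Module F H]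
  [FiniteDimensional F H]

/-- The eigenspace of the `q`-adjacency matrix `A` for the eigenvalue `θ_{k/2}`. -/
def eigA (h : Submodule F H) (q N M k : ℕ) : Submodule ℂ (AttX h → ℂ) :=
  Module.End.eigenspace (Matrix.toLin' (Amat h q)) ((theta q N M k : ℝ) : ℂ)

theorem Smat_mulVec_Smat_mulVec (h : Submodule F H) (v : AttX h → ℂ) :
    Smat h *ᵥ (Smat h *ᵥ v) = v := by
  ext y
  simp only [Smat, Matrix.mulVec_diagonal, ← mul_assoc, ← mul_pow]
  simp

theorem Amat_mul_Smat (h : Submodule F H) (q : ℕ) :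
    Amat h q * Smat h = -(Smat h * Amat h q) := by
  ext y z
  simp only [Smat, Matrix.neg_apply, Matrix.mul_diagonal, Matrix.diagonal_mul, Amat]
  split_ifs with h₁ h₂
  · rw [h₁.2, pow_succ]; ring
  · rw [h₂.2, pow_succ]; ring
  · simp

theorem theta_two_mul_sub (q N M k : ℕ) (hk : k ≤ 2 * N) :
    theta q N M (2 * N - k) = -theta q N M k := by
  unfold theta
  rw [Nat.sub_sub_self hk]
  ring

theorem Smat_mulVec_mem_eigA (q N M : ℕ) (h : Submodule F H) (k : ℕ) (hk : k ≤ 2 * N)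
    (v : AttX h → ℂ) (hv : v ∈ eigA h q N M k) :
    Smat h *ᵥ v ∈ eigA h q N M (2 * N - k) := by
  rw [eigA, Module.End.mem_eigenspace_iff, Matrix.toLin'_apply] at hv ⊢
  rw [Matrix.mulVec_mulVec, Amat_mul_Smat, Matrix.neg_mulVec, ← Matrix.mulVec_mulVec, hv,
    Matrix.mulVec_smul, theta_two_mul_sub q N M k hk, Complex.ofReal_neg, neg_smul]

/-- `S` maps the eigenspace of `A` for `θ_i` onto the eigenspace of `A`
for `θ_(N-i)`.  Here `i = k/2 ∈ [N]` is encoded by `k : ℕ`, `k ≤ 2N`, so that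
`N - i` is encoded by `2N - k`. -/
theorem stmt12 (q N M : ℕ) (hq : Fintype.card F = q) (hN : 0 < N) (hM : 0 < M)
    (h : Submodule F H) (hH : finrank F H = N + M) (hh : finrank F h = M)
    (k : ℕ) (hk : k ≤ 2 * N) :
    Submodule.map (Matrix.toLin' (Smat h)) (eigA h q N M k) = eigA h q N M (2 * N - k) := by
  ext v
  rw [Submodule.mem_map]
  constructor
  · rintro ⟨w, hw, rfl⟩
    exact Smat_mulVec_mem_eigA q N M h k hk w hw
  · intro hv
    refine ⟨Smat h *ᵥ v, ?_, ?_⟩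
    · have hs := Smat_mulVec_mem_eigA q N M h (2 * N - k) (Nat.sub_le _ _) v hv
      rwa [Nat.sub_sub_self hk] at hs
    · exact Smat_mulVec_Smat_mulVec h v
end
end
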